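/- Duoandikoetxea–Rosenthal extrapolation to weighted Morrey spaces: Let 1 ≤ κ ≤ p₁ < ∞ and let T be an operator defined and bounded on L^{p₁}(w) for all weights w ∈ A_{p₁/κ}(ℝ^d). Then for every σ ∈ (1,∞), T is bounded on 𝓛^{p,λ}(w) for all p ∈ (κ,∞) (and also for p = κ if p₁ = κ), all λ with 0 < λ < d − d/σ, and all weights w ∈ A_{p/κ}(ℝ^d) ∩ RH_σ(ℝ^d). -/

import Mathlib

open MeasureTheory Filter ENNReal
open scoped ENNReal NNReal Topology

noncomputable section

namespace PaperMorrey

/-! ### Cubes, weights, Muckenhoupt classes -/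

/-- The axis-parallel cube with corner `a` and side length `r`. -/
def cube {d : ℕ} (a : Fin d → ℝ) (r : ℝ) : Set (Fin d → ℝ) :=
  Set.univ.pi fun i => Set.Icc (a i) (a i + r)

/-- A weight on `ℝ^d`: a locally integrable, a.e. positive function. -/
def IsWeight (d : ℕ) (w : (Fin d → ℝ) → ℝ) : Prop :=
  LocallyIntegrable w volume ∧ ∀ᵐ x ∂(volume : Measure (Fin d → ℝ)), 0 < w x

/-- Interpret a real-valued weight as an `ℝ≥0∞`-valued function. -/
def ofW {d : ℕ} (w : (Fin d → ℝ) → ℝ) : (Fin d → ℝ) → ℝ≥0∞ :=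
  fun x => ENNReal.ofReal (w x)

/-- Average `⟨g⟩_Q = |Q|⁻¹ ∫_Q g` of an `ℝ≥0∞`-valued function over a cube. -/
def avg {d : ℕ} (g : (Fin d → ℝ) → ℝ≥0∞) (a : Fin d → ℝ) (r : ℝ) : ℝ≥0∞ :=
  (∫⁻ x in cube a r, g x) / volume (cube a r)

open Classical in
/-- The Muckenhoupt `A_p` characteristic `[w]_{A_p}` of a weight, for a finite
exponent `1 ≤ p < ∞` (with the usual `L^∞` form when `p = 1`). -/
def apConst (d : ℕ) (p : ℝ) (w : (Fin d → ℝ) → ℝ) : ℝ≥0∞ :=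
  if p = 1 then
    ⨆ (a : Fin d → ℝ) (r : ℝ) (_ : 0 < r),
      avg (ofW w) a r * essSup (fun x => (ofW w x)⁻¹) (volume.restrict (cube a r))
  else
    ⨆ (a : Fin d → ℝ) (r : ℝ) (_ : 0 < r),
      avg (ofW w) a r * (avg (fun x => ofW w x ^ (-(1 / (p - 1)))) a r) ^ (p - 1)

/-- Membership `w ∈ A_p(ℝ^d)` for finite `p ≥ 1`. -/
def MemAp (d : ℕ) (p : ℝ) (w : (Fin d → ℝ) → ℝ) : Prop :=
  IsWeight d w ∧ apConst d p w ≠ ⊤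

open Classical in
/-- The reverse Hölder `RH_σ` characteristic, for `σ ∈ [1,∞]` (an extended real);
`σ = 1` corresponds to the trivial class of all weights. -/
def rhConst (d : ℕ) (σ : ℝ≥0∞) (w : (Fin d → ℝ) → ℝ) : ℝ≥0∞ :=
  if σ = 1 then 0
  else if σ = ⊤ then
    ⨆ (a : Fin d → ℝ) (r : ℝ) (_ : 0 < r),
      essSup (ofW w) (volume.restrict (cube a r)) / avg (ofW w) a r
  else
    ⨆ (a : Fin d → ℝ) (r : ℝ) (_ : 0 < r),
      (avg (fun x => ofW w x ^ σ.toReal) a r) ^ (1 / σ.toReal) / avg (ofW w) a r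

/-- Membership `w ∈ RH_σ(ℝ^d)` for `σ ∈ [1,∞]`; `RH_1` is the class of all weights. -/
def MemRH (d : ℕ) (σ : ℝ≥0∞) (w : (Fin d → ℝ) → ℝ) : Prop :=
  IsWeight d w ∧ rhConst d σ w ≠ ⊤

open Classical in
/-- The conjugate exponent `q' = q/(q-1) ∈ [1,∞]` of a real exponent `q ≥ 1`,
as an extended real (`1' = ∞`). -/
def eConj (q : ℝ) : ℝ≥0∞ :=
  if q ≤ 1 then ⊤ else ENNReal.ofReal (q / (q - 1))

open Classical in
/-- The conjugate exponent `(p₊/p)'` of the ratio of an extended exponent `p₊ ∈ (1,∞]`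
and a finite exponent `p`; in particular it equals `1` when `p₊ = ∞`. -/
def ratioConj (pp : ℝ≥0∞) (p : ℝ) : ℝ≥0∞ :=
  if pp = ⊤ then 1 else eConj (pp.toReal / p)

/-! ### Weighted Lebesgue and Morrey norms -/

/-- The weighted Lebesgue norm `‖f‖_{L^p(w)} = (∫_{ℝ^d} |f|^p w)^{1/p}` (finite `p`). -/
def wLpNorm (d : ℕ) (p : ℝ) (w : (Fin d → ℝ) → ℝ) (f : (Fin d → ℝ) → ℂ) : ℝ≥0∞ :=
  (∫⁻ x, (‖f x‖₊ : ℝ≥0∞) ^ p * ofW w x) ^ (1 / p)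

/-- The Samko weighted Morrey norm
`‖f‖_{𝓛^{p,λ}(w)} = sup_Q |Q|^{-λ/(dp)} (∫_Q |f|^p w)^{1/p}`. -/
def morreyNorm (d : ℕ) (p lam : ℝ) (w : (Fin d → ℝ) → ℝ) (f : (Fin d → ℝ) → ℂ) : ℝ≥0∞ :=
  ⨆ (a : Fin d → ℝ) (r : ℝ) (_ : 0 < r),
    volume (cube a r) ^ (-(lam / ((d : ℝ) * p))) *
      (∫⁻ x in cube a r, (‖f x‖₊ : ℝ≥0∞) ^ p * ofW w x) ^ (1 / p)

/-! ### Bounded and compact operators w.r.t. extended (semi)norms -/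

/-- `T` is a bounded operator from the space with extended norm `N`
to the space with extended norm `M`. -/
def OpBounded {V W : Type*} (N : V → ℝ≥0∞) (M : W → ℝ≥0∞) (T : V → W) : Prop :=
  ∃ C : ℝ≥0∞, C ≠ ⊤ ∧ ∀ f, M (T f) ≤ C * N f

/-- `T` is a compact operator from the space with extended norm `N` to the
(complete) space with extended norm `M`: the image of the unit ball is
totally bounded, i.e. every sequence in it has a subsequence whose image
is Cauchy in `M`. -/
def OpCompact {V W : Type*} [AddCommGroup W] (N : V → ℝ≥0∞) (M : W → ℝ≥0∞) (T : V → W) : Prop :=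
  ∀ f : ℕ → V, (∀ n, N (f n) ≤ 1) →
    ∃ φ : ℕ → ℕ, StrictMono φ ∧
      ∀ ε : ℝ≥0∞, 0 < ε → ∃ K : ℕ, ∀ m ≥ K, ∀ n ≥ K,
        M (T (f (φ m)) - T (f (φ n))) < ε

/-! ### BMO, CMO and commutators -/

/-- Average of a real function over a cube. -/
def cavg {d : ℕ} (g : (Fin d → ℝ) → ℝ) (a : Fin d → ℝ) (r : ℝ) : ℝ :=
  (volume (cube a r)).toReal⁻¹ * ∫ x in cube a r, g x

/-- The BMO norm `sup_Q ⟨|b - ⟨b⟩_Q|⟩_Q`. -/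
def bmoNorm (d : ℕ) (b : (Fin d → ℝ) → ℝ) : ℝ≥0∞ :=
  ⨆ (a : Fin d → ℝ) (r : ℝ) (_ : 0 < r),
    ENNReal.ofReal (cavg (fun x => |b x - cavg b a r|) a r)

/-- `b ∈ BMO(ℝ^d)`. -/
def MemBMO (d : ℕ) (b : (Fin d → ℝ) → ℝ) : Prop :=
  LocallyIntegrable b volume ∧ bmoNorm d b ≠ ⊤

/-- `b ∈ CMO(ℝ^d)`: `b` lies in the closure of `C_c^∞(ℝ^d)` in the BMO norm. -/
def MemCMO (d : ℕ) (b : (Fin d → ℝ) → ℝ) : Prop :=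
  MemBMO d b ∧ ∀ ε : ℝ≥0∞, 0 < ε → ∃ g : (Fin d → ℝ) → ℝ,
    ContDiff ℝ (⊤ : ℕ∞) g ∧ HasCompactSupport g ∧ bmoNorm d (fun x => b x - g x) < ε

/-- The commutator `[b,T] f = b · T f - T (b · f)`. -/
def commutator {d : ℕ} (b : (Fin d → ℝ) → ℝ)
    (T : ((Fin d → ℝ) → ℂ) → ((Fin d → ℝ) → ℂ)) :
    ((Fin d → ℝ) → ℂ) → ((Fin d → ℝ) → ℂ) :=
  fun f x => (b x : ℂ) * T f x - T (fun y => (b y : ℂ) * f y) x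

/-- The Euclidean norm on `ℝ^d` (the underlying type carries the sup norm). -/
def euclidNorm {d : ℕ} (x : Fin d → ℝ) : ℝ :=
  Real.sqrt (∑ i, x i ^ 2)

end PaperMorrey

open PaperMorrey MeasureTheory ENNReal

namespace WeightedMorrey

open Metric

/-! ### The centred maximal operator of a measure, over balls of dyadic radius -/

/-- The centred maximal function of `f` with respect to `μ`, over balls of dyadic radius. -/
def maximal {d : ℕ} (μ : Measure (Fin d → ℝ)) (f : (Fin d → ℝ) → ℝ≥0∞) (x : Fin d → ℝ) : ℝ≥0∞ :=
  ⨆ k : ℤ, (∫⁻ y in closedBall x ((2 : ℝ) ^ k), f y ∂μ) / μ (closedBall x ((2 : ℝ) ^ k))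

lemma measurable_setLIntegral_closedBall {d : ℕ} (μ : Measure (Fin d → ℝ)) [SFinite μ]
    {f : (Fin d → ℝ) → ℝ≥0∞} (hf : Measurable f) (r : ℝ) :
    Measurable fun x => ∫⁻ y in closedBall x r, f y ∂μ := by
  have h : Measurable fun p : (Fin d → ℝ) × (Fin d → ℝ) =>
      {p : (Fin d → ℝ) × (Fin d → ℝ) | dist p.2 p.1 ≤ r}.indicator (fun p => f p.2) p :=
    (hf.comp measurable_snd).indicator
      (measurableSet_le (measurable_snd.dist measurable_fst) measurable_const)
  convert h.lintegral_prod_right' (ν := μ) using 2 with x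
  rw [← lintegral_indicator measurableSet_closedBall]
  rfl

lemma measurable_maximal {d : ℕ} (μ : Measure (Fin d → ℝ)) [SFinite μ]
    {f : (Fin d → ℝ) → ℝ≥0∞} (hf : Measurable f) : Measurable (maximal μ f) := by
  refine Measurable.iSup fun k => (measurable_setLIntegral_closedBall μ hf _).div ?_
  simpa using measurable_setLIntegral_closedBall μ (measurable_const (a := (1 : ℝ≥0∞))) ((2 : ℝ) ^ k)

lemma setLIntegral_div_le_maximal {d : ℕ} (μ : Measure (Fin d → ℝ))
    (f : (Fin d → ℝ) → ℝ≥0∞) (x : Fin d → ℝ) (k : ℤ) :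
    (∫⁻ y in closedBall x ((2 : ℝ) ^ k), f y ∂μ) / μ (closedBall x ((2 : ℝ) ^ k)) ≤ maximal μ f x :=
  le_iSup (fun k : ℤ => (∫⁻ y in closedBall x ((2 : ℝ) ^ k), f y ∂μ) /
    μ (closedBall x ((2 : ℝ) ^ k))) k

/-- The weak type `(1,1)` inequality, with a constant independent of the measure. -/
lemma exists_weak_type (d : ℕ) : ∃ N : ℕ, ∀ (μ : Measure (Fin d → ℝ)) (f : (Fin d → ℝ) → ℝ≥0∞)
    (t : ℝ≥0∞), t * μ {x | t < maximal μ f x} ≤ N * ∫⁻ x, f x ∂μ := by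
  obtain ⟨N, τ, hτ, hN⟩ := HasBesicovitchCovering.no_satelliteConfig (α := Fin d → ℝ)
  refine ⟨N, fun μ f t => ?_⟩
  let A : ℤ → Set (Fin d → ℝ) := fun K => {x | ∃ k : ℤ, k ≤ K ∧
    t < (∫⁻ y in closedBall x ((2 : ℝ) ^ k), f y ∂μ) / μ (closedBall x ((2 : ℝ) ^ k))}
  have hA : {x | t < maximal μ f x} = ⋃ K, A K := by
    ext x
    simp only [maximal, lt_iSup_iff, Set.mem_ofPred_eq, Set.mem_iUnion, A]
    exact ⟨fun ⟨k, hk⟩ => ⟨k, k, le_rfl, hk⟩, fun ⟨_, k, _, hk⟩ => ⟨k, hk⟩⟩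
  have hmono : Monotone A := fun K L hKL x ⟨k, hk, h⟩ => ⟨k, hk.trans hKL, h⟩
  rw [hA, hmono.measure_iUnion, ENNReal.mul_iSup]
  refine iSup_le fun K => ?_
  choose k hk ht using fun x : A K => x.2
  let q : Besicovitch.BallPackage (A K) (Fin d → ℝ) :=
    { c := fun x => x
      r := fun x => (2 : ℝ) ^ k x
      rpos := fun x => by positivity
      r_bound := (2 : ℝ) ^ K
      r_le := fun x => zpow_le_zpow_right₀ (by norm_num) (hk x) }
  obtain ⟨s, hs, hcov⟩ := Besicovitch.exist_disjoint_covering_families hτ hN q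
  have hcount : ∀ i, (s i).Countable := fun i =>
    (hs i).countable_of_nonempty_interior fun j _ =>
      ⟨q.c j, ball_subset_interior_closedBall (mem_ball_self (q.rpos j))⟩
  have hcov' : A K ⊆ ⋃ i : Fin N, ⋃ j ∈ s i, closedBall (q.c j) (q.r j) := fun x hx => by
    have h : x ∈ Set.range q.c := ⟨⟨x, hx⟩, rfl⟩
    have h2 := hcov h
    simp only [Set.mem_iUnion] at h2 ⊢
    obtain ⟨i, j, hj, hx⟩ := h2
    exact ⟨i, j, hj, ball_subset_closedBall hx⟩
  calc t * μ (A K) ≤ t * ∑ i : Fin N, μ (⋃ j ∈ s i, closedBall (q.c j) (q.r j)) := by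
        gcongr
        exact (measure_mono hcov').trans (measure_iUnion_fintype_le _ _)
    _ = ∑ i : Fin N, t * μ (⋃ j ∈ s i, closedBall (q.c j) (q.r j)) := Finset.mul_sum _ _ _
    _ ≤ ∑ i : Fin N, ∫⁻ x, f x ∂μ := by
        refine Finset.sum_le_sum fun i _ => ?_
        have := (hcount i).to_subtype
        calc t * μ (⋃ j ∈ s i, closedBall (q.c j) (q.r j))
            ≤ t * ∑' j : s i, μ (closedBall (q.c j) (q.r j)) := by
              gcongr
              exact measure_biUnion_le _ (hcount i) _
          _ = ∑' j : s i, t * μ (closedBall (q.c j) (q.r j)) := ENNReal.tsum_mul_left.symm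
          _ ≤ ∑' j : s i, ∫⁻ x in closedBall (q.c j) (q.r j), f x ∂μ :=
              ENNReal.tsum_le_tsum fun j => (ENNReal.mul_lt_of_lt_div (ht j)).le
          _ = ∫⁻ x in ⋃ j ∈ s i, closedBall (q.c j) (q.r j), f x ∂μ :=
              (lintegral_biUnion (hcount i) (fun j _ => measurableSet_closedBall) (hs i) f).symm
          _ ≤ ∫⁻ x, f x ∂μ := setLIntegral_le_lintegral _ _
    _ = N * ∫⁻ x, f x ∂μ := by simp

lemma tsum_two_sided_geometric_ne_top {η : ℝ≥0∞} (hη : η < 1) :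
    ∑' k : ℤ, η ^ k.natAbs ≠ ∞ := by
  have h : ∑' k : ℕ, η ^ k ≠ ∞ := by
    rw [ENNReal.tsum_geometric]
    simpa [tsub_eq_zero_iff_le] using hη
  rw [tsum_of_nat_of_neg_add_one ENNReal.summable ENNReal.summable]
  refine ENNReal.add_ne_top.2 ⟨by simpa using h, ne_top_of_le_ne_top h ?_⟩
  refine ENNReal.tsum_le_tsum fun n => ?_
  have : (-((n : ℤ) + 1)).natAbs = n + 1 := by omega
  rw [this]
  exact pow_le_pow_right_of_le_one' hη.le (Nat.le_succ n)

/-- A dyadic layer-cake bound for a power. -/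
lemma rpow_le_tsum_dyadic {p : ℝ} (hp : 0 < p) (a : ℝ≥0∞) :
    a ^ p ≤ ∑' k : ℤ, {b : ℝ≥0∞ | 2 * 2 ^ k < b}.indicator (fun _ => (4 * (2 : ℝ≥0∞) ^ k) ^ p) a := by
  rcases eq_or_ne a 0 with rfl | h0
  · simp [hp]
  rcases eq_or_ne a ∞ with rfl | h1
  · refine le_of_le_of_eq le_top (Eq.symm ?_)
    rw [eq_top_iff]
    calc ∞ = ∑' _ : ℕ, (1 : ℝ≥0∞) := (ENNReal.tsum_const_eq_top_of_ne_zero one_ne_zero).symm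
      _ ≤ ∑' k : ℕ, {b : ℝ≥0∞ | 2 * 2 ^ (k : ℤ) < b}.indicator
            (fun _ => (4 * (2 : ℝ≥0∞) ^ (k : ℤ)) ^ p) ∞ := by
          refine ENNReal.tsum_le_tsum fun k => ?_
          have h : (2 : ℝ≥0∞) * 2 ^ (k : ℤ) < ∞ := by
            rw [zpow_natCast]
            exact ENNReal.mul_lt_top (by simp) (ENNReal.pow_lt_top (by simp))
          rw [Set.indicator_of_mem (by simpa using h), zpow_natCast]
          exact ENNReal.one_le_rpow (one_le_mul (by norm_num) (one_le_pow₀ (by norm_num))) hp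
      _ ≤ _ := ENNReal.tsum_comp_le_tsum_of_injective (f := fun k : ℕ => (k : ℤ))
          Nat.cast_injective _
  obtain ⟨n, hn1, hn2⟩ := ENNReal.exists_mem_Ioc_zpow h0 h1 (y := 2) (by norm_num) (by simp)
  refine le_trans ?_ (ENNReal.le_tsum (n - 1))
  have h2 : (2 : ℝ≥0∞) * 2 ^ (n - 1) = 2 ^ n := by
    have := ENNReal.zpow_add (x := 2) (by simp) (by simp) 1 (n - 1)
    rw [zpow_one] at this
    rw [← this]; congr 1; ring
  have h3 : (4 : ℝ≥0∞) * 2 ^ (n - 1) = 2 ^ (n + 1) := by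
    rw [ENNReal.zpow_add (by simp) (by simp), ← h2, zpow_one]; ring
  rw [Set.indicator_of_mem (by simpa [h2] using hn1), h3]
  gcongr

lemma tsum_dyadic_le {p : ℝ} (hp : 1 < p) : ∃ C : ℝ≥0∞, C ≠ ∞ ∧ ∀ b : ℝ≥0∞,
    b * ∑' k : ℤ, {b : ℝ≥0∞ | 2 ^ k < b}.indicator
      (fun _ => (4 * (2 : ℝ≥0∞) ^ k) ^ p * ((2 : ℝ≥0∞) ^ k)⁻¹) b ≤ C * b ^ p := by
  set η : ℝ≥0∞ := (2⁻¹) ^ (p - 1) with hη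
  have hη1 : η < 1 := ENNReal.rpow_lt_one (by simp) (by linarith)
  refine ⟨4 ^ p * ∑' k : ℤ, η ^ k.natAbs + 1, ?_, fun b => ?_⟩
  · exact ENNReal.add_ne_top.2 ⟨ENNReal.mul_ne_top
      (ENNReal.rpow_ne_top_of_nonneg (by linarith) (by simp))
      (tsum_two_sided_geometric_ne_top hη1), by simp⟩
  rcases eq_or_ne b 0 with rfl | h0
  · simp
  rcases eq_or_ne b ∞ with rfl | h1
  · rw [ENNReal.top_rpow_of_pos (by linarith), ENNReal.mul_top (by simp)]
    exact le_top
  obtain ⟨n, hn1, hn2⟩ := ENNReal.exists_mem_Ioc_zpow h0 h1 (y := 2) (by norm_num) (by simp)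
  have key : ∀ k : ℤ, {b : ℝ≥0∞ | 2 ^ k < b}.indicator
      (fun _ => (4 * (2 : ℝ≥0∞) ^ k) ^ p * ((2 : ℝ≥0∞) ^ k)⁻¹) b ≤
        4 ^ p * b ^ (p - 1) * η ^ (k - n).natAbs := fun k => by
    by_cases hk : 2 ^ k < b
    swap
    · simp [Set.indicator, hk]
    rw [Set.indicator_of_mem (by exact hk)]
    have hkn : k ≤ n := by
      by_contra! hcon
      have : (2 : ℝ≥0∞) ^ (n + 1) ≤ 2 ^ k :=
        ENNReal.zpow_le_of_le (by norm_num) (by omega)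
      exact absurd (hk.trans_le (hn2.trans this)) (lt_irrefl _)
    have hs0 : (2 : ℝ≥0∞) ^ k ≠ 0 := (ENNReal.zpow_pos (by simp) (by simp) k).ne'
    have hs1 : (2 : ℝ≥0∞) ^ k ≠ ∞ := (ENNReal.zpow_lt_top (by simp) (by simp) k).ne
    have hdec : (2 : ℝ≥0∞) ^ k = 2 ^ n * (2⁻¹) ^ (k - n).natAbs := by
      have : k = n - ((k - n).natAbs : ℤ) := by omega
      conv_lhs => rw [this]
      rw [ENNReal.zpow_sub (by simp) (by simp), zpow_natCast, ENNReal.inv_pow]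
    calc (4 * (2 : ℝ≥0∞) ^ k) ^ p * ((2 : ℝ≥0∞) ^ k)⁻¹
        = 4 ^ p * (2 ^ k) ^ (p - 1) := by
          rw [ENNReal.mul_rpow_of_nonneg _ _ (by linarith), ENNReal.rpow_sub _ _ hs0 hs1,
            ENNReal.rpow_one, div_eq_mul_inv, mul_assoc]
      _ = 4 ^ p * ((2 ^ n) ^ (p - 1) * η ^ (k - n).natAbs) := by
          rw [hdec, ENNReal.mul_rpow_of_nonneg _ _ (by linarith), hη, ← ENNReal.rpow_natCast,
            ← ENNReal.rpow_mul, mul_comm ((_ : ℕ) : ℝ), ENNReal.rpow_mul, ENNReal.rpow_natCast]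
      _ ≤ 4 ^ p * (b ^ (p - 1) * η ^ (k - n).natAbs) := by
          gcongr
      _ = _ := (mul_assoc _ _ _).symm
  calc _ ≤ b * ∑' k : ℤ, 4 ^ p * b ^ (p - 1) * η ^ (k - n).natAbs := by
        gcongr with k
        exact key k
    _ = 4 ^ p * (∑' k : ℤ, η ^ (k - n).natAbs) * (b * b ^ (p - 1)) := by
        rw [ENNReal.tsum_mul_left]; ring
    _ ≤ 4 ^ p * (∑' k : ℤ, η ^ k.natAbs) * (b * b ^ (p - 1)) := by
        refine mul_le_mul_left (mul_le_mul_right ?_ _) _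
        exact ENNReal.tsum_comp_le_tsum_of_injective (f := fun k : ℤ => k - n)
          sub_left_injective (fun k : ℤ => η ^ k.natAbs)
    _ = 4 ^ p * (∑' k : ℤ, η ^ k.natAbs) * b ^ p := by
        congr 1
        have := ENNReal.rpow_add_of_nonneg (x := b) 1 (p - 1) zero_le_one (by linarith)
        rw [ENNReal.rpow_one] at this
        rw [← this]
        congr 1
        ring
    _ ≤ _ := by gcongr; exact le_self_add

lemma maximal_le_add {d : ℕ} (μ : Measure (Fin d → ℝ)) {f : (Fin d → ℝ) → ℝ≥0∞}
    (hf : Measurable f) (t : ℝ≥0∞) (x : Fin d → ℝ) :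
    maximal μ f x ≤ maximal μ ({y | t < f y}.indicator f) x + t := by
  refine iSup_le fun k => ?_
  have hm : Measurable ({y | t < f y}.indicator f) :=
    hf.indicator (measurableSet_lt measurable_const hf)
  calc (∫⁻ y in closedBall x ((2 : ℝ) ^ k), f y ∂μ) / μ (closedBall x ((2 : ℝ) ^ k))
      ≤ (∫⁻ y in closedBall x ((2 : ℝ) ^ k), ({y | t < f y}.indicator f y + t) ∂μ) /
          μ (closedBall x ((2 : ℝ) ^ k)) := by
        refine ENNReal.div_le_div_right (lintegral_mono fun y => ?_) _
        by_cases h : t < f y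
        · simp [Set.indicator, h]
        · rw [Set.indicator_of_notMem (by exact h), zero_add]
          exact not_lt.1 h
    _ = (∫⁻ y in closedBall x ((2 : ℝ) ^ k), {y | t < f y}.indicator f y ∂μ) /
          μ (closedBall x ((2 : ℝ) ^ k)) +
          t * (μ (closedBall x ((2 : ℝ) ^ k)) / μ (closedBall x ((2 : ℝ) ^ k))) := by
        rw [lintegral_add_left hm, setLIntegral_const, ENNReal.add_div, mul_div_assoc]
    _ ≤ maximal μ ({y | t < f y}.indicator f) x + t * 1 := by
        gcongr
        · exact setLIntegral_div_le_maximal _ _ _ _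
        · exact ENNReal.div_self_le_one
    _ = _ := by rw [mul_one]

/-- The strong type inequality, with a constant independent of the measure. -/
lemma exists_strong_type (d : ℕ) {p : ℝ} (hp : 1 < p) : ∃ C : ℝ≥0∞, C ≠ ∞ ∧
    ∀ (μ : Measure (Fin d → ℝ)) (f : (Fin d → ℝ) → ℝ≥0∞), Measurable f →
      ∫⁻ x, maximal μ f x ^ p ∂μ ≤ C * ∫⁻ x, f x ^ p ∂μ := by
  obtain ⟨N, hN⟩ := exists_weak_type d
  obtain ⟨C, hC, hCb⟩ := tsum_dyadic_le hp
  refine ⟨N * C, ENNReal.mul_ne_top (ENNReal.natCast_ne_top N) hC, fun μ f hf => ?_⟩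
  let E : ℤ → Set (Fin d → ℝ) := fun k => toMeasurable μ {x | 2 * 2 ^ k < maximal μ f x}
  have hE : ∀ k : ℤ, μ (E k) ≤
      N * ((2 : ℝ≥0∞) ^ k)⁻¹ * ∫⁻ x, {y | 2 ^ k < f y}.indicator f x ∂μ := fun k => by
    have h0 : (2 : ℝ≥0∞) ^ k ≠ 0 := (ENNReal.zpow_pos (by simp) (by simp) k).ne'
    have h1 : (2 : ℝ≥0∞) ^ k ≠ ∞ := (ENNReal.zpow_lt_top (by simp) (by simp) k).ne
    have h := hN μ ({y | 2 ^ k < f y}.indicator f) (2 ^ k)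
    have h2 : μ (E k) ≤ μ {x | 2 ^ k < maximal μ ({y | 2 ^ k < f y}.indicator f) x} := by
      rw [measure_toMeasurable]
      refine measure_mono fun x hx => ?_
      have h3 := lt_of_lt_of_le hx (maximal_le_add μ hf (2 ^ k) x)
      rw [two_mul] at h3
      exact lt_of_add_lt_add_right h3
    calc μ (E k) = (2 ^ k)⁻¹ * (2 ^ k * μ (E k)) := by
          rw [← mul_assoc, ENNReal.inv_mul_cancel h0 h1, one_mul]
      _ ≤ (2 ^ k)⁻¹ * (N * ∫⁻ x, {y | 2 ^ k < f y}.indicator f x ∂μ) := by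
          exact mul_le_mul_right ((mul_le_mul_right h2 _).trans h) _
      _ = _ := by ring
  have hmeas : ∀ k : ℤ, MeasurableSet {y | 2 ^ k < f y} := fun k =>
    measurableSet_lt measurable_const hf
  calc ∫⁻ x, maximal μ f x ^ p ∂μ
      ≤ ∫⁻ x, ∑' k : ℤ, (E k).indicator (fun _ => (4 * (2 : ℝ≥0∞) ^ k) ^ p) x ∂μ := by
        refine lintegral_mono fun x => (rpow_le_tsum_dyadic (by linarith) _).trans ?_
        refine ENNReal.tsum_le_tsum fun k => ?_
        by_cases h : 2 * 2 ^ k < maximal μ f x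
        · have : x ∈ E k := subset_toMeasurable _ _ h
          simp [Set.indicator, this, h]
        · simp [Set.indicator, h]
    _ = ∑' k : ℤ, (4 * (2 : ℝ≥0∞) ^ k) ^ p * μ (E k) := by
        rw [lintegral_tsum fun k => (measurable_const.indicator
          (measurableSet_toMeasurable _ _)).aemeasurable]
        congr 1 with k
        rw [lintegral_indicator_const (measurableSet_toMeasurable _ _)]
    _ ≤ ∑' k : ℤ, ∫⁻ x, N * (f x * {b : ℝ≥0∞ | 2 ^ k < b}.indicator
          (fun _ => (4 * (2 : ℝ≥0∞) ^ k) ^ p * ((2 : ℝ≥0∞) ^ k)⁻¹) (f x)) ∂μ := by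
        refine ENNReal.tsum_le_tsum fun k => ?_
        calc _ ≤ (4 * (2 : ℝ≥0∞) ^ k) ^ p *
              (N * ((2 : ℝ≥0∞) ^ k)⁻¹ * ∫⁻ x, {y | 2 ^ k < f y}.indicator f x ∂μ) := by
                gcongr; exact hE k
          _ = ((4 * (2 : ℝ≥0∞) ^ k) ^ p * N * ((2 : ℝ≥0∞) ^ k)⁻¹) *
                ∫⁻ x, {y | 2 ^ k < f y}.indicator f x ∂μ := by ring
          _ = _ := by
            rw [← lintegral_const_mul _ (hf.indicator (hmeas k))]
            congr 1 with x
            by_cases h : 2 ^ k < f x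
            · simp [Set.indicator, h]; ring
            · simp [Set.indicator, h]
    _ = ∫⁻ x, N * (f x * ∑' k : ℤ, {b : ℝ≥0∞ | 2 ^ k < b}.indicator
          (fun _ => (4 * (2 : ℝ≥0∞) ^ k) ^ p * ((2 : ℝ≥0∞) ^ k)⁻¹) (f x)) ∂μ := by
        rw [← lintegral_tsum]
        · simp_rw [ENNReal.tsum_mul_left]
        · intro k
          refine (Measurable.const_mul (hf.mul ?_) _).aemeasurable
          exact (measurable_const.indicator (measurableSet_lt measurable_const measurable_id)).comp hf
    _ ≤ ∫⁻ x, N * (C * f x ^ p) ∂μ := by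
        exact lintegral_mono fun x => mul_le_mul_right (hCb _) _
    _ = _ := by
        rw [← lintegral_const_mul _ (hf.pow_const p)]
        simp_rw [mul_assoc]

/-! ### Extended-valued weights and Muckenhoupt's theorem -/

/-- A locally integrable, a.e. positive weight with values in `ℝ≥0∞`. -/
structure IsLocWeight {d : ℕ} (v : (Fin d → ℝ) → ℝ≥0∞) : Prop where
  measurable : Measurable v
  ne_zero : ∀ᵐ x, v x ≠ 0
  ne_top : ∀ᵐ x, v x ≠ ∞
  locFin : ∀ c r, ∫⁻ x in closedBall c r, v x ≠ ∞

/-- The class `A_1`, written over closed balls of the sup norm, i.e. cubes. -/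
def MuckOne {d : ℕ} (v : (Fin d → ℝ) → ℝ≥0∞) : Prop :=
  IsLocWeight v ∧ ∃ K : ℝ≥0∞, K ≠ ∞ ∧ ∀ c r, 0 < r → ∀ᵐ x ∂volume.restrict (closedBall c r),
    ∫⁻ y in closedBall c r, v y ≤ K * volume (closedBall c r) * v x

/-- The class `A_s` for `1 < s`, written over closed balls of the sup norm, i.e. cubes. -/
def Muck {d : ℕ} (s : ℝ) (v : (Fin d → ℝ) → ℝ≥0∞) : Prop :=
  IsLocWeight v ∧ ∃ K : ℝ≥0∞, K ≠ ∞ ∧ ∀ c r, 0 < r →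
    (∫⁻ y in closedBall c r, v y) * (∫⁻ y in closedBall c r, v y ^ (-(1 / (s - 1)))) ^ (s - 1) ≤
      K * volume (closedBall c r) ^ s

lemma volume_closedBall_mul {d : ℕ} (c c' : Fin d → ℝ) {t r : ℝ} (ht : 0 ≤ t) (hr : 0 ≤ r) :
    volume (closedBall c (t * r)) = ENNReal.ofReal t ^ d * volume (closedBall c' r) := by
  rw [Real.volume_pi_closedBall _ (mul_nonneg ht hr), Real.volume_pi_closedBall _ hr,
    Fintype.card_fin, ← ENNReal.ofReal_pow ht, ← ENNReal.ofReal_mul (by positivity)]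
  congr 1
  rw [← mul_pow]
  ring

lemma volume_closedBall_ne_zero {d : ℕ} (c : Fin d → ℝ) {r : ℝ} (hr : 0 < r) :
    volume (closedBall c r) ≠ 0 :=
  (measure_closedBall_pos volume c hr).ne'

lemma volume_closedBall_ne_top {d : ℕ} (c : Fin d → ℝ) (r : ℝ) :
    volume (closedBall c r) ≠ ∞ :=
  measure_closedBall_lt_top.ne

lemma setLIntegral_ne_zero {d : ℕ} {v : (Fin d → ℝ) → ℝ≥0∞} (hv : Measurable v)
    (h0 : ∀ᵐ x, v x ≠ 0) (c : Fin d → ℝ) {r : ℝ} (hr : 0 < r) :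
    ∫⁻ x in closedBall c r, v x ≠ 0 := by
  intro h
  rw [lintegral_eq_zero_iff hv] at h
  have h2 : ∀ᵐ x ∂volume.restrict (closedBall c r), False := by
    filter_upwards [h, ae_restrict_of_ae h0] with x hx hx0 using hx0 hx
  rw [ae_iff] at h2
  have h3 : (volume.restrict (closedBall c r)) Set.univ = 0 := by simpa using h2
  rw [Measure.restrict_apply_univ] at h3
  exact volume_closedBall_ne_zero c hr h3

lemma Muck.isLocWeight_dual {d : ℕ} {s : ℝ} (hs : 1 < s) {v : (Fin d → ℝ) → ℝ≥0∞}
    (hv : Muck s v) : IsLocWeight fun x => v x ^ (-(1 / (s - 1))) := by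
  obtain ⟨hw, K, hK, h⟩ := hv
  have hs' : 0 < s - 1 := by linarith
  have he : 0 < 1 / (s - 1) := by positivity
  refine ⟨hw.measurable.pow_const _, ?_, ?_, fun c r => ?_⟩
  · filter_upwards [hw.ne_top, hw.ne_zero] with x h1 h0
    exact (ENNReal.rpow_pos (pos_iff_ne_zero.2 h0) h1).ne'
  · filter_upwards [hw.ne_top, hw.ne_zero] with x h1 h0
    exact ENNReal.rpow_ne_top_of_ne_zero h0 h1
  · have hmain : ∀ r, 0 < r → ∫⁻ x in closedBall c r, v x ^ (-(1 / (s - 1))) ≠ ∞ := by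
      intro r hr htop
      have h1 := h c r hr
      rw [htop, ENNReal.top_rpow_of_pos hs',
        ENNReal.mul_top (setLIntegral_ne_zero hw.measurable hw.ne_zero c hr), top_le_iff] at h1
      exact ENNReal.mul_ne_top hK (ENNReal.rpow_ne_top_of_nonneg (by linarith)
        (volume_closedBall_ne_top c r)) h1
    exact ne_top_of_le_ne_top (hmain (max r 1) (by positivity))
      (lintegral_mono_set (closedBall_subset_closedBall (le_max_left _ _)))

lemma Muck.dual {d : ℕ} {s : ℝ} (hs : 1 < s) {v : (Fin d → ℝ) → ℝ≥0∞}
    (hv : Muck s v) : Muck (s / (s - 1)) fun x => v x ^ (-(1 / (s - 1))) := by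
  refine ⟨hv.isLocWeight_dual hs, ?_⟩
  obtain ⟨hw, K, hK, h⟩ := hv
  have hs' : 0 < s - 1 := by linarith
  have e1 : s / (s - 1) - 1 = 1 / (s - 1) := by field_simp; ring
  refine ⟨K ^ (1 / (s - 1)), ENNReal.rpow_ne_top_of_nonneg (by positivity) hK, fun c r hr => ?_⟩
  have h1 := ENNReal.rpow_le_rpow (h c r hr) (z := 1 / (s - 1)) (by positivity)
  rw [ENNReal.mul_rpow_of_nonneg _ _ (by positivity),
    ENNReal.mul_rpow_of_nonneg _ _ (by positivity), ← ENNReal.rpow_mul, ← ENNReal.rpow_mul,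
    mul_one_div_cancel hs'.ne', ENNReal.rpow_one, mul_one_div] at h1
  rw [e1, mul_comm]
  refine le_trans (le_of_eq ?_) h1
  congr 2
  refine lintegral_congr_ae (ae_restrict_of_ae ?_)
  filter_upwards with x
  rw [← ENNReal.rpow_mul]
  have : -(1 / (s - 1)) * -(1 / (1 / (s - 1))) = 1 := by field_simp
  rw [this, ENNReal.rpow_one]

lemma setLIntegral_le_mul_maximal {d : ℕ} {μ : Measure (Fin d → ℝ)} (f : (Fin d → ℝ) → ℝ≥0∞)
    (x : Fin d → ℝ) (k : ℤ) (h0 : μ (closedBall x ((2 : ℝ) ^ k)) ≠ 0)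
    (h1 : μ (closedBall x ((2 : ℝ) ^ k)) ≠ ∞) :
    ∫⁻ y in closedBall x ((2 : ℝ) ^ k), f y ∂μ ≤
      μ (closedBall x ((2 : ℝ) ^ k)) * maximal μ f x := by
  rw [mul_comm]
  exact (ENNReal.div_le_iff h0 h1).1 (setLIntegral_div_le_maximal μ f x k)

lemma lintegral_withDensity {d : ℕ} {v g : (Fin d → ℝ) → ℝ≥0∞} (hv : Measurable v)
    (hg : Measurable g) : ∫⁻ x, g x ∂volume.withDensity v = ∫⁻ x, v x * g x :=
  lintegral_withDensity_eq_lintegral_mul _ hv hg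

lemma setLIntegral_withDensity {d : ℕ} {v g : (Fin d → ℝ) → ℝ≥0∞} (hv : Measurable v)
    (hg : Measurable g) {B : Set (Fin d → ℝ)} (hB : MeasurableSet B) :
    ∫⁻ x in B, g x ∂volume.withDensity v = ∫⁻ x in B, v x * g x :=
  setLIntegral_withDensity_eq_setLIntegral_mul _ hv hg hB

/-- Lerner's pointwise bound: the maximal function is controlled by iterated weighted ones. -/
lemma maximal_rpow_le {d : ℕ} {s : ℝ} (hs : 1 < s) {v : (Fin d → ℝ) → ℝ≥0∞}
    (hw : IsLocWeight v) (hσ : IsLocWeight fun x => v x ^ (-(1 / (s - 1)))) {K : ℝ≥0∞}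
    (hK : ∀ c r, 0 < r →
      (∫⁻ y in closedBall c r, v y) * (∫⁻ y in closedBall c r, v y ^ (-(1 / (s - 1)))) ^ (s - 1) ≤
      K * volume (closedBall c r) ^ s)
    {f : (Fin d → ℝ) → ℝ≥0∞} (hf : Measurable f) (x : Fin d → ℝ) :
    maximal volume f x ^ (s - 1) ≤ K * ((3 : ℝ≥0∞) ^ d) ^ s *
      maximal (volume.withDensity v) (fun y =>
        maximal (volume.withDensity fun x => v x ^ (-(1 / (s - 1))))
          (fun z => f z / v z ^ (-(1 / (s - 1)))) y ^ (s - 1) / v y) x := by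
  have hs' : 0 < s - 1 := by linarith
  set σ : (Fin d → ℝ) → ℝ≥0∞ := fun x => v x ^ (-(1 / (s - 1))) with hσdef
  set μ := volume.withDensity v with hμ
  set ν := volume.withDensity σ with hν
  set G := maximal ν (fun z => f z / σ z) with hG
  set g : (Fin d → ℝ) → ℝ≥0∞ := fun y => G y ^ (s - 1) / v y with hg
  have hfσ : Measurable fun z => f z / σ z := hf.div hσ.measurable
  have hGm : Measurable G := measurable_maximal ν hfσ
  have hgm : Measurable g := (hGm.pow_const _).div hw.measurable
  rw [← ENNReal.le_rpow_inv_iff hs']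
  refine iSup_le fun k => ?_
  rw [ENNReal.le_rpow_inv_iff hs']
  set r : ℝ := (2 : ℝ) ^ k with hr
  have hr0 : 0 < r := by positivity
  set B := closedBall x r with hB
  have hBm : MeasurableSet B := measurableSet_closedBall
  have hB0 : volume B ≠ 0 := volume_closedBall_ne_zero x hr0
  have hB1 : volume B ≠ ∞ := volume_closedBall_ne_top x r
  have hμB0 : μ B ≠ 0 := by
    rw [hμ, withDensity_apply _ hBm]; exact setLIntegral_ne_zero hw.measurable hw.ne_zero x hr0
  have hμB1 : μ B ≠ ∞ := by rw [hμ, withDensity_apply _ hBm]; exact hw.locFin x r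
  set I := ∫⁻ y in B, f y with hI
  set n := ν (closedBall x (3 * r)) with hn
  have step1 : ∀ y ∈ B, I ≤ n * G y := fun y hy => by
    have h2r : (2 : ℝ) ^ (k + 1) = 2 * r := by rw [zpow_add₀ (by norm_num), hr]; ring
    have hyx : dist y x ≤ r := hy
    have hsub1 : B ⊆ closedBall y ((2 : ℝ) ^ (k + 1)) := by
      rw [h2r]; refine closedBall_subset_closedBall' ?_; rw [dist_comm]; linarith
    have hsub2 : closedBall y ((2 : ℝ) ^ (k + 1)) ⊆ closedBall x (3 * r) := by
      rw [h2r]; refine closedBall_subset_closedBall' ?_; linarith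
    calc I = ∫⁻ z in B, f z / σ z ∂ν := by
          rw [hν, setLIntegral_withDensity hσ.measurable hfσ hBm]
          refine lintegral_congr_ae (ae_restrict_of_ae ?_)
          filter_upwards [hσ.ne_zero, hσ.ne_top] with z h0 h1
          exact (ENNReal.mul_div_cancel h0 h1).symm
      _ ≤ ∫⁻ z in closedBall y ((2 : ℝ) ^ (k + 1)), f z / σ z ∂ν := lintegral_mono_set hsub1
      _ ≤ ν (closedBall y ((2 : ℝ) ^ (k + 1))) * G y := by
          refine setLIntegral_le_mul_maximal _ y (k + 1) ?_ ?_
          · rw [hν, withDensity_apply _ measurableSet_closedBall]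
            exact setLIntegral_ne_zero hσ.measurable hσ.ne_zero y (by positivity)
          · rw [hν, withDensity_apply _ measurableSet_closedBall]
            exact hσ.locFin _ _
      _ ≤ n * G y := mul_le_mul_left (measure_mono hsub2) _
  have step2 : I ^ (s - 1) * volume B ≤ n ^ (s - 1) * (μ (closedBall x (3 * r)) * maximal μ g x) := by
    calc I ^ (s - 1) * volume B = ∫⁻ _ in B, I ^ (s - 1) := by rw [setLIntegral_const]
      _ ≤ ∫⁻ y in B, n ^ (s - 1) * G y ^ (s - 1) := by
          refine setLIntegral_mono ((hGm.pow_const _).const_mul _) fun y hy => ?_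
          rw [← ENNReal.mul_rpow_of_nonneg _ _ hs'.le]
          exact ENNReal.rpow_le_rpow (step1 y hy) hs'.le
      _ = n ^ (s - 1) * ∫⁻ y in B, G y ^ (s - 1) := lintegral_const_mul _ (hGm.pow_const _)
      _ = n ^ (s - 1) * ∫⁻ y in B, g y ∂μ := by
          rw [hμ, setLIntegral_withDensity hw.measurable hgm hBm]
          congr 1
          refine lintegral_congr_ae (ae_restrict_of_ae ?_)
          filter_upwards [hw.ne_zero, hw.ne_top] with z h0 h1
          exact (ENNReal.mul_div_cancel h0 h1).symm
      _ ≤ n ^ (s - 1) * (μ B * maximal μ g x) :=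
          mul_le_mul_right (setLIntegral_le_mul_maximal _ x k hμB0 hμB1) _
      _ ≤ _ := by
          refine mul_le_mul_right (mul_le_mul_left (measure_mono ?_) _) _
          exact closedBall_subset_closedBall (by linarith)
  have step3 : μ (closedBall x (3 * r)) * n ^ (s - 1) ≤
      K * ((3 : ℝ≥0∞) ^ d) ^ s * volume B ^ s := by
    have h := hK x (3 * r) (by positivity)
    rw [volume_closedBall_mul x x (by norm_num) hr0.le, ENNReal.mul_rpow_of_nonneg _ _ (by linarith),
      ← mul_assoc] at h
    rw [hn, hμ, hν, withDensity_apply _ measurableSet_closedBall,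
      withDensity_apply _ measurableSet_closedBall]
    simpa using h
  rw [ENNReal.div_rpow_of_nonneg _ _ hs'.le]
  have hpow0 : volume B ^ (s - 1) ≠ 0 := (ENNReal.rpow_pos (pos_iff_ne_zero.2 hB0) hB1).ne'
  have hpow1 : volume B ^ (s - 1) ≠ ∞ := ENNReal.rpow_ne_top_of_nonneg hs'.le hB1
  rw [ENNReal.div_le_iff hpow0 hpow1]
  rw [← ENNReal.mul_le_mul_iff_left hB0 hB1]
  calc I ^ (s - 1) * volume B ≤ (μ (closedBall x (3 * r)) * n ^ (s - 1)) * maximal μ g x := by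
        refine step2.trans (le_of_eq (by ring))
    _ ≤ (K * ((3 : ℝ≥0∞) ^ d) ^ s * volume B ^ s) * maximal μ g x := mul_le_mul_left step3 _
    _ = K * ((3 : ℝ≥0∞) ^ d) ^ s * maximal μ g x * volume B ^ (s - 1) * volume B := by
        have : volume B ^ s = volume B ^ (s - 1) * volume B := by
          rw [ENNReal.rpow_sub _ _ hB0 hB1, ENNReal.rpow_one, ENNReal.div_mul_cancel hB0 hB1]
        rw [this]; ring

/-- Muckenhoupt's theorem. -/
lemma Muck.exists_maximal_bound {d : ℕ} {s : ℝ} (hs : 1 < s) {v : (Fin d → ℝ) → ℝ≥0∞}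
    (hv : Muck s v) : ∃ C : ℝ≥0∞, C ≠ ∞ ∧ ∀ f : (Fin d → ℝ) → ℝ≥0∞, Measurable f →
      ∫⁻ x, maximal volume f x ^ s * v x ≤ C * ∫⁻ x, f x ^ s * v x := by
  have hs' : 0 < s - 1 := by linarith
  have hσ := hv.isLocWeight_dual hs
  obtain ⟨hw, K, hK, hAs⟩ := hv
  set s' : ℝ := s / (s - 1) with hs'def
  have hs'1 : 1 < s' := by rw [hs'def, lt_div_iff₀ hs']; linarith
  obtain ⟨C₁, hC₁, h₁⟩ := exists_strong_type d hs
  obtain ⟨C₂, hC₂, h₂⟩ := exists_strong_type d hs'1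
  set C₀ : ℝ≥0∞ := K * ((3 : ℝ≥0∞) ^ d) ^ s with hC₀def
  have hC₀ : C₀ ≠ ∞ := ENNReal.mul_ne_top hK
    (ENNReal.rpow_ne_top_of_nonneg (by linarith) (ENNReal.pow_ne_top (by simp)))
  refine ⟨C₀ ^ s' * (C₂ * C₁), ENNReal.mul_ne_top
    (ENNReal.rpow_ne_top_of_nonneg (by linarith) hC₀) (ENNReal.mul_ne_top hC₂ hC₁), fun f hf => ?_⟩
  set σ : (Fin d → ℝ) → ℝ≥0∞ := fun x => v x ^ (-(1 / (s - 1))) with hσdef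
  set μ := volume.withDensity v with hμ
  set ν := volume.withDensity σ with hν
  set G := maximal ν (fun z => f z / σ z) with hG
  set g : (Fin d → ℝ) → ℝ≥0∞ := fun y => G y ^ (s - 1) / v y with hg
  have hfσ : Measurable fun z => f z / σ z := hf.div hσ.measurable
  have hGm : Measurable G := measurable_maximal ν hfσ
  have hgm : Measurable g := (hGm.pow_const _).div hw.measurable
  have hMgm : Measurable (maximal μ g) := measurable_maximal μ hgm
  have hss' : (s - 1) * s' = s := by rw [hs'def]; field_simp
  calc ∫⁻ x, maximal volume f x ^ s * v x
      ≤ ∫⁻ x, C₀ ^ s' * (v x * maximal μ g x ^ s') := by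
        refine lintegral_mono fun x => ?_
        have h := ENNReal.rpow_le_rpow (maximal_rpow_le hs hw hσ hAs hf x) (z := s') (by linarith)
        rw [← ENNReal.rpow_mul, hss', ENNReal.mul_rpow_of_nonneg _ _ (by linarith)] at h
        calc _ ≤ _ := mul_le_mul_left h _
          _ = _ := by ring
    _ = C₀ ^ s' * ∫⁻ x, maximal μ g x ^ s' ∂μ := by
        have hm : Measurable fun x => v x * maximal μ g x ^ s' :=
          hw.measurable.mul (hMgm.pow_const _)
        rw [lintegral_const_mul _ hm, ← lintegral_withDensity hw.measurable (hMgm.pow_const _)]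
    _ ≤ C₀ ^ s' * (C₂ * ∫⁻ x, g x ^ s' ∂μ) := mul_le_mul_right (h₂ μ g hgm) _
    _ = C₀ ^ s' * (C₂ * ∫⁻ x, G x ^ s ∂ν) := by
        rw [hμ, hν, lintegral_withDensity hw.measurable (hgm.pow_const _),
          lintegral_withDensity hσ.measurable (hGm.pow_const _)]
        congr 2
        refine lintegral_congr_ae ?_
        filter_upwards [hw.ne_zero, hw.ne_top] with x h0 h1
        simp only [hg, hσdef]
        rw [ENNReal.div_rpow_of_nonneg _ _ (by linarith), ← ENNReal.rpow_mul, hss']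
        have : v x ^ (-(1 / (s - 1))) = v x / v x ^ s' := by
          have e : -(1 / (s - 1)) = 1 - s' := by rw [hs'def]; field_simp; ring
          rw [e, ENNReal.rpow_sub _ _ h0 h1, ENNReal.rpow_one]
        rw [this]
        simp only [div_eq_mul_inv]; ring
    _ ≤ C₀ ^ s' * (C₂ * (C₁ * ∫⁻ x, (f x / σ x) ^ s ∂ν)) :=
        mul_le_mul_right (mul_le_mul_right (h₁ ν _ hfσ) _) _
    _ = C₀ ^ s' * (C₂ * (C₁ * ∫⁻ x, f x ^ s * v x)) := by
        rw [hν, lintegral_withDensity hσ.measurable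
          (hfσ.pow_const _)]
        congr 3
        refine lintegral_congr_ae ?_
        filter_upwards [hw.ne_zero, hw.ne_top] with x h0 h1
        simp only [hσdef]
        have : -(1 / (s - 1)) + -(1 / (s - 1)) * -s = 1 := by field_simp; ring
        rw [ENNReal.div_rpow_of_nonneg _ _ (by linarith), ENNReal.div_eq_inv_mul,
          ← ENNReal.rpow_neg, ← ENNReal.rpow_mul, ← mul_assoc, ← ENNReal.rpow_add _ _ h0 h1, this,
          ENNReal.rpow_one, mul_comm]
    _ = _ := by ring

/-! ### The Rubio de Francia iteration -/

lemma maximal_tsum_le {d : ℕ} (μ : Measure (Fin d → ℝ)) {g : ℕ → (Fin d → ℝ) → ℝ≥0∞}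
    (hg : ∀ k, Measurable (g k)) (x : Fin d → ℝ) :
    maximal μ (fun y => ∑' k, g k y) x ≤ ∑' k, maximal μ (g k) x := by
  refine iSup_le fun j => ?_
  rw [lintegral_tsum fun k => (hg k).aemeasurable, div_eq_mul_inv, ← ENNReal.tsum_mul_right]
  exact ENNReal.tsum_le_tsum fun k => setLIntegral_div_le_maximal μ (g k) x j

lemma maximal_const_mul {d : ℕ} (μ : Measure (Fin d → ℝ)) (c : ℝ≥0∞) {g : (Fin d → ℝ) → ℝ≥0∞}
    (hg : Measurable g) (x : Fin d → ℝ) :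
    maximal μ (fun y => c * g y) x = c * maximal μ g x := by
  simp only [maximal, ENNReal.mul_iSup, lintegral_const_mul _ hg, mul_div_assoc]

/-- If `∫ φ^s v` is finite then so is `∫ φ` over balls. -/
lemma Muck.setLIntegral_ne_top {d : ℕ} {s : ℝ} (hs : 1 < s) {v : (Fin d → ℝ) → ℝ≥0∞}
    (hv : Muck s v) {φ : (Fin d → ℝ) → ℝ≥0∞} (hφ : Measurable φ)
    (hfin : ∫⁻ x, φ x ^ s * v x ≠ ∞) (c : Fin d → ℝ) (r : ℝ) :
    ∫⁻ x in closedBall c r, φ x ≠ ∞ := by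
  have hs' : 0 < s - 1 := by linarith
  have hσ := hv.isLocWeight_dual hs
  have h := ENNReal.lintegral_mul_norm_pow_le (μ := volume.restrict (closedBall c r))
    (((hφ.pow_const s).mul hv.1.measurable).aemeasurable) hσ.measurable.aemeasurable
    (p := 1 / s) (q := (s - 1) / s) (by positivity) (by positivity) (by field_simp; ring)
  refine ne_top_of_le_ne_top (ENNReal.mul_ne_top ?_ ?_) (le_trans (le_of_eq ?_) h)
  · exact ENNReal.rpow_ne_top_of_nonneg (by positivity)
      (ne_top_of_le_ne_top hfin (setLIntegral_le_lintegral _ _))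
  · exact ENNReal.rpow_ne_top_of_nonneg (by positivity) (hσ.locFin c r)
  · refine lintegral_congr_ae (ae_restrict_of_ae ?_)
    filter_upwards [hv.1.ne_zero, hv.1.ne_top] with x h0 h1
    have e1 : s * (1 / s) = 1 := by field_simp
    have e2 : 1 / s + -(1 / (s - 1)) * ((s - 1) / s) = 0 := by field_simp; ring
    simp only [Pi.mul_apply]
    rw [ENNReal.mul_rpow_of_nonneg _ _ (by positivity), ← ENNReal.rpow_mul, ← ENNReal.rpow_mul, e1,
      ENNReal.rpow_one, mul_assoc, ← ENNReal.rpow_add _ _ h0 h1, e2, ENNReal.rpow_zero, mul_one]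

/-- A function with `M Φ ≤ L Φ` which is not negligible is an `A_1` weight. -/
lemma MuckOne.of_maximal_le {d : ℕ} {Φ : (Fin d → ℝ) → ℝ≥0∞} (hΦ : Measurable Φ)
    (htop : ∀ᵐ x, Φ x ≠ ∞) (hfin : ∀ c r, ∫⁻ x in closedBall c r, Φ x ≠ ∞)
    (hpos : ∀ x ∈ closedBall (0 : Fin d → ℝ) 1, 1 ≤ Φ x) {L : ℝ≥0∞} (hL : L ≠ ∞)
    (hM : ∀ x, maximal volume Φ x ≤ L * Φ x) : MuckOne Φ := by
  have key : ∀ c r, 0 < r → ∀ x ∈ closedBall c r,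
      ∫⁻ y in closedBall c r, Φ y ≤ (4 : ℝ≥0∞) ^ d * L * volume (closedBall c r) * Φ x := by
    intro c r hr x hx
    obtain ⟨n, hn1, hn2⟩ := exists_mem_Ioc_zpow (x := 2 * r) (y := (2 : ℝ)) (by positivity)
      (by norm_num)
    have h2 : (2 : ℝ) ^ (n + 1) = 2 ^ n * 2 := zpow_add_one₀ (by norm_num) n
    have hxc : dist x c ≤ r := hx
    calc ∫⁻ y in closedBall c r, Φ y ≤ ∫⁻ y in closedBall x ((2 : ℝ) ^ (n + 1)), Φ y := by
          refine lintegral_mono_set (closedBall_subset_closedBall' ?_)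
          rw [dist_comm]; linarith
      _ ≤ volume (closedBall x ((2 : ℝ) ^ (n + 1))) * maximal volume Φ x :=
          setLIntegral_le_mul_maximal _ x _ (volume_closedBall_ne_zero _ (by positivity))
            (volume_closedBall_ne_top _ _)
      _ ≤ volume (closedBall x (4 * r)) * (L * Φ x) :=
          mul_le_mul' (measure_mono (closedBall_subset_closedBall (by linarith))) (hM x)
      _ = _ := by
          rw [volume_closedBall_mul x c (by norm_num) hr.le]
          simp only [ENNReal.ofReal_ofNat]; ring
  refine ⟨⟨hΦ, .of_forall fun x h0 => ?_, htop, hfin⟩, (4 : ℝ≥0∞) ^ d * L,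
    ENNReal.mul_ne_top (ENNReal.pow_ne_top (by simp)) hL, fun c r hr => ?_⟩
  · have h1 := key 0 (max 1 (dist x 0)) (by positivity) x (mem_closedBall.2 (le_max_right _ _))
    rw [h0, mul_zero, nonpos_iff_eq_zero] at h1
    have h2 : volume (closedBall (0 : Fin d → ℝ) 1) ≤ 0 := by
      rw [← h1]
      calc volume (closedBall (0 : Fin d → ℝ) 1) = ∫⁻ _ in closedBall (0 : Fin d → ℝ) 1, 1 := by
            simp
        _ ≤ ∫⁻ y in closedBall (0 : Fin d → ℝ) 1, Φ y := setLIntegral_mono hΦ hpos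
        _ ≤ _ := lintegral_mono_set (closedBall_subset_closedBall (le_max_left _ _))
    exact volume_closedBall_ne_zero 0 one_pos (nonpos_iff_eq_zero.1 h2)
  · filter_upwards [ae_restrict_mem measurableSet_closedBall] with x hx using key c r hr x hx

/-- The Rubio de Francia algorithm: a function in `L^s(v)`, `v ∈ A_s`, has an `A_1` majorant
in `L^s(v)`. -/
lemma Muck.exists_muckOne_majorant {d : ℕ} {s : ℝ} (hs : 1 < s) {v : (Fin d → ℝ) → ℝ≥0∞}
    (hv : Muck s v) {φ : (Fin d → ℝ) → ℝ≥0∞} (hφ : Measurable φ)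
    (hfin : ∫⁻ x, φ x ^ s * v x ≠ ∞) :
    ∃ Φ : (Fin d → ℝ) → ℝ≥0∞, MuckOne Φ ∧ (∀ x, φ x ≤ Φ x) ∧ ∫⁻ x, Φ x ^ s * v x ≠ ∞ := by
  have hs0 : 0 < s := by linarith
  obtain ⟨B, hB, hBound⟩ := hv.exists_maximal_bound hs
  set C : ℝ≥0∞ := B + 1 with hC
  have hC0 : C ≠ 0 := by simp [hC]
  have hC1 : C ≠ ∞ := by simp [hC, hB]
  obtain ⟨D, hD0, hD1, hDs⟩ : ∃ D : ℝ≥0∞, D ≠ 0 ∧ D ≠ ∞ ∧ D ^ s = 2 * C :=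
    ⟨(2 * C) ^ (1 / s), (ENNReal.rpow_pos (pos_iff_ne_zero.2 (by simp [hC0]))
      (ENNReal.mul_ne_top (by simp) hC1)).ne', ENNReal.rpow_ne_top_of_nonneg (by positivity)
      (ENNReal.mul_ne_top (by simp) hC1),
      by rw [← ENNReal.rpow_mul, one_div_mul_cancel hs0.ne', ENNReal.rpow_one]⟩
  set φ₀ : (Fin d → ℝ) → ℝ≥0∞ := fun x =>
    φ x + (closedBall (0 : Fin d → ℝ) 1).indicator (fun _ => 1) x with hφ₀
  have hind : Measurable ((closedBall (0 : Fin d → ℝ) 1).indicator fun _ => (1 : ℝ≥0∞)) :=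
    measurable_const.indicator measurableSet_closedBall
  have hφ₀m : Measurable φ₀ := hφ.add hind
  have hφ₀fin : ∫⁻ x, φ₀ x ^ s * v x ≠ ∞ := by
    have h1 : ∀ x, φ₀ x ^ s * v x ≤ (2 : ℝ≥0∞) ^ (s - 1) * (φ x ^ s * v x +
        (closedBall (0 : Fin d → ℝ) 1).indicator v x) := fun x => by
      have h := ENNReal.rpow_add_le_mul_rpow_add_rpow (φ x)
        ((closedBall (0 : Fin d → ℝ) 1).indicator (fun _ => 1) x) hs.le
      refine (mul_le_mul_left h (v x)).trans (le_of_eq ?_)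
      rw [mul_assoc, add_mul]
      by_cases hx : x ∈ closedBall (0 : Fin d → ℝ) 1
      · simp [hx]
      · simp [hx, hs0]
    refine ne_top_of_le_ne_top ?_ (lintegral_mono h1)
    have hm : Measurable fun x => φ x ^ s * v x := (hφ.pow_const s).mul hv.1.measurable
    rw [lintegral_const_mul' _ _ (ENNReal.rpow_ne_top_of_nonneg (by linarith) (by simp)),
      lintegral_add_left hm,
      lintegral_indicator measurableSet_closedBall]
    exact ENNReal.mul_ne_top (ENNReal.rpow_ne_top_of_nonneg (by linarith) (by simp))
      (ENNReal.add_ne_top.2 ⟨hfin, hv.1.locFin 0 1⟩)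
  set a : ℕ → (Fin d → ℝ) → ℝ≥0∞ := fun k => (maximal volume)^[k] φ₀ with ha
  have ha_succ : ∀ k, a (k + 1) = maximal volume (a k) := fun k =>
    Function.iterate_succ_apply' _ _ _
  have ham : ∀ k, Measurable (a k) := by
    intro k
    induction k with
    | zero => exact hφ₀m
    | succ k ih => rw [ha_succ]; exact measurable_maximal _ ih
  have haint : ∀ k, ∫⁻ x, a k x ^ s * v x ≤ C ^ k * ∫⁻ x, φ₀ x ^ s * v x := by
    intro k
    induction k with
    | zero => simp [ha]
    | succ k ih =>
      rw [ha_succ, pow_succ', mul_assoc]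
      exact (hBound _ (ham k)).trans (mul_le_mul' (by simp [hC]) ih)
  set Φ : (Fin d → ℝ) → ℝ≥0∞ := fun x => ∑' k, (2 * D)⁻¹ ^ k * a k x with hΦ
  have h2D0 : 2 * D ≠ 0 := by simp [hD0]
  have h2D1 : 2 * D ≠ ∞ := ENNReal.mul_ne_top (by simp) hD1
  have htermm : ∀ k, Measurable fun x => (2 * D)⁻¹ ^ k * a k x := fun k => (ham k).const_mul _
  have hΦm : Measurable Φ := Measurable.tsum htermm
  have hφ₀Φ : ∀ x, φ₀ x ≤ Φ x := fun x => by
    refine le_trans (le_of_eq ?_) (ENNReal.le_tsum (f := fun k => (2 * D)⁻¹ ^ k * a k x) 0)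
    simp [ha]
  have hMΦ : ∀ x, maximal volume Φ x ≤ 2 * D * Φ x := fun x => by
    refine (maximal_tsum_le volume htermm x).trans ?_
    calc ∑' k, maximal volume (fun y => (2 * D)⁻¹ ^ k * a k y) x
        = ∑' k, 2 * D * ((2 * D)⁻¹ ^ (k + 1) * a (k + 1) x) := by
          refine tsum_congr fun k => ?_
          rw [maximal_const_mul _ _ (ham k), ha_succ, pow_succ']
          simp only [← mul_assoc]
          rw [ENNReal.mul_inv_cancel h2D0 h2D1, one_mul]
      _ = 2 * D * ∑' k, (2 * D)⁻¹ ^ (k + 1) * a (k + 1) x := ENNReal.tsum_mul_left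
      _ ≤ 2 * D * Φ x := mul_le_mul_right
          (ENNReal.tsum_comp_le_tsum_of_injective (add_left_injective 1)
            fun k => (2 * D)⁻¹ ^ k * a k x) _
  have hΦs : ∀ x, Φ x ^ s ≤ 2 ^ s * ∑' k, ((2 * C)⁻¹ ^ k * a k x ^ s) := fun x => by
    set m := ∑' k, ((2 * C)⁻¹ ^ k * a k x ^ s) with hm
    have hk : ∀ k, D⁻¹ ^ k * a k x ≤ m ^ (1 / s) := fun k => by
      rw [one_div, ENNReal.le_rpow_inv_iff hs0]
      refine le_trans (le_of_eq ?_) (ENNReal.le_tsum k)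
      rw [ENNReal.mul_rpow_of_nonneg _ _ hs0.le, ← hDs, ← ENNReal.inv_rpow, ← ENNReal.rpow_natCast,
        ← ENNReal.rpow_natCast, ← ENNReal.rpow_mul, ← ENNReal.rpow_mul, mul_comm (k : ℝ) s]
    have h1 : Φ x ≤ 2 * m ^ (1 / s) := by
      calc Φ x = ∑' k, 2⁻¹ ^ k * (D⁻¹ ^ k * a k x) := by
            refine tsum_congr fun k => ?_
            rw [ENNReal.mul_inv (.inl (by simp)) (.inl (by simp)), mul_pow, mul_assoc]
        _ ≤ ∑' k, 2⁻¹ ^ k * m ^ (1 / s) :=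
            ENNReal.tsum_le_tsum fun k => mul_le_mul_right (hk k) _
        _ = _ := by rw [ENNReal.tsum_mul_right, ENNReal.tsum_geometric_two]
    refine (ENNReal.rpow_le_rpow h1 hs0.le).trans (le_of_eq ?_)
    rw [ENNReal.mul_rpow_of_nonneg _ _ hs0.le, ← ENNReal.rpow_mul, one_div_mul_cancel hs0.ne',
      ENNReal.rpow_one]
  have hΦfin : ∫⁻ x, Φ x ^ s * v x ≠ ∞ := by
    have hkm : ∀ k, Measurable fun x => (2 * C)⁻¹ ^ k * (a k x ^ s * v x) := fun k =>
      (((ham k).pow_const s).mul hv.1.measurable).const_mul _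
    have h1 : ∫⁻ x, Φ x ^ s * v x ≤ 2 ^ s * (2 * ∫⁻ x, φ₀ x ^ s * v x) := by
      calc ∫⁻ x, Φ x ^ s * v x
          ≤ ∫⁻ x, 2 ^ s * ∑' k, (2 * C)⁻¹ ^ k * (a k x ^ s * v x) := by
            refine lintegral_mono fun x => (mul_le_mul_left (hΦs x) _).trans (le_of_eq ?_)
            rw [mul_assoc, ← ENNReal.tsum_mul_right]
            simp only [mul_assoc]
        _ = 2 ^ s * ∑' k, (2 * C)⁻¹ ^ k * ∫⁻ x, a k x ^ s * v x := by
            rw [lintegral_const_mul _ (Measurable.tsum hkm),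
              lintegral_tsum fun k => (hkm k).aemeasurable]
            congr 1
            exact tsum_congr fun k =>
              lintegral_const_mul _ (((ham k).pow_const s).mul hv.1.measurable)
        _ ≤ 2 ^ s * ∑' k, 2⁻¹ ^ k * ∫⁻ x, φ₀ x ^ s * v x := by
            refine mul_le_mul_right (ENNReal.tsum_le_tsum fun k => ?_) _
            refine (mul_le_mul_right (haint k) _).trans (le_of_eq ?_)
            rw [← mul_assoc, ← mul_pow, ENNReal.mul_inv (.inl (by simp)) (.inl (by simp)),
              mul_assoc, ENNReal.inv_mul_cancel hC0 hC1, mul_one]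
        _ = _ := by rw [ENNReal.tsum_mul_right, ENNReal.tsum_geometric_two]
    exact ne_top_of_le_ne_top (ENNReal.mul_ne_top (ENNReal.rpow_ne_top_of_nonneg hs0.le (by simp))
      (ENNReal.mul_ne_top (by simp) hφ₀fin)) h1
  refine ⟨Φ, MuckOne.of_maximal_le hΦm ?_ (hv.setLIntegral_ne_top hs hΦm hΦfin) (fun x hx => ?_)
    h2D1 hMΦ, fun x => (hφ₀Φ x).trans' (by simp [hφ₀]), hΦfin⟩
  · filter_upwards [ae_lt_top ((hΦm.pow_const s).mul hv.1.measurable) hΦfin, hv.1.ne_zero]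
      with x hx h0 htop
    simp [htop, hs0, ENNReal.top_mul h0] at hx
  · refine le_trans ?_ (hφ₀Φ x)
    simp [hφ₀, Set.indicator_of_mem hx]

/-! ### Products of powers of Muckenhoupt weights -/

lemma MuckOne.rpow_neg_le {d : ℕ} {Φ : (Fin d → ℝ) → ℝ≥0∞} (hΦ : MuckOne Φ) :
    ∃ K : ℝ≥0∞, K ≠ ∞ ∧ ∀ c r, 0 < r → ∀ e : ℝ, 0 ≤ e →
      ∀ᵐ x ∂volume.restrict (closedBall c r),
        Φ x ^ (-e) ≤ (K * volume (closedBall c r) / ∫⁻ y in closedBall c r, Φ y) ^ e := by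
  obtain ⟨hw, K, hK, h⟩ := hΦ
  refine ⟨K, hK, fun c r hr e he => ?_⟩
  filter_upwards [h c r hr] with x hx
  rw [ENNReal.rpow_neg, ← ENNReal.inv_rpow]
  refine ENNReal.rpow_le_rpow ?_ he
  rw [ENNReal.le_div_iff_mul_le (.inl (setLIntegral_ne_zero hw.measurable hw.ne_zero c hr))
    (.inl (hw.locFin c r))]
  calc (Φ x)⁻¹ * ∫⁻ y in closedBall c r, Φ y
      ≤ (Φ x)⁻¹ * (K * volume (closedBall c r) * Φ x) := mul_le_mul_right hx _
    _ = K * volume (closedBall c r) * ((Φ x)⁻¹ * Φ x) := by ring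
    _ ≤ K * volume (closedBall c r) * 1 := mul_le_mul_right (ENNReal.inv_mul_le_one _) _
    _ = _ := mul_one _

lemma IsLocWeight.mul_rpow {d : ℕ} {Φ V : (Fin d → ℝ) → ℝ≥0∞} (hΦ : IsLocWeight Φ)
    (hV : IsLocWeight V) (a b : ℝ)
    (hfin : ∀ c r, 0 < r → ∫⁻ x in closedBall c r, Φ x ^ a * V x ^ b ≠ ∞) :
    IsLocWeight fun x => Φ x ^ a * V x ^ b := by
  refine ⟨(hΦ.measurable.pow_const _).mul (hV.measurable.pow_const _), ?_, ?_, fun c r => ?_⟩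
  · filter_upwards [hΦ.ne_zero, hΦ.ne_top, hV.ne_zero, hV.ne_top] with x h1 h2 h3 h4
    exact mul_ne_zero (ENNReal.rpow_pos (pos_iff_ne_zero.2 h1) h2).ne'
      (ENNReal.rpow_pos (pos_iff_ne_zero.2 h3) h4).ne'
  · filter_upwards [hΦ.ne_zero, hΦ.ne_top, hV.ne_zero, hV.ne_top] with x h1 h2 h3 h4
    exact ENNReal.mul_ne_top (ENNReal.rpow_ne_top_of_ne_zero h1 h2)
      (ENNReal.rpow_ne_top_of_ne_zero h3 h4)
  · exact ne_top_of_le_ne_top (hfin c (max r 1) (by positivity))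
      (lintegral_mono_set (closedBall_subset_closedBall (le_max_left _ _)))

lemma div_rpow_mul_rpow {A I : ℝ≥0∞} (h0 : I ≠ 0) (h1 : I ≠ ∞) {e : ℝ} (he : 0 ≤ e) :
    (A / I) ^ e * I ^ e = A ^ e := by
  rw [← ENNReal.mul_rpow_of_nonneg _ _ he, ENNReal.div_mul_cancel h0 h1]

lemma MuckOne.rpow_mul_rpow {d : ℕ} {q θ : ℝ} (hq : 1 < q) (hθ0 : 0 < θ) (hθ1 : θ < 1)
    {Φ V : (Fin d → ℝ) → ℝ≥0∞} (hΦ : MuckOne Φ) (hV : Muck q V) :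
    Muck (1 + (q - 1) * (1 - θ)) fun x => Φ x ^ θ * V x ^ (1 - θ) := by
  obtain ⟨K, hK, hKΦ⟩ := hΦ.rpow_neg_le
  obtain ⟨hΦw, -⟩ := hΦ
  have hσ := hV.isLocWeight_dual hq
  obtain ⟨hVw, K', hK', hKV⟩ := hV
  have hq' : 0 < q - 1 := by linarith
  have hθ' : 0 < 1 - θ := by linarith
  have hW : ∀ c r, ∫⁻ x in closedBall c r, Φ x ^ θ * V x ^ (1 - θ) ≤
      (∫⁻ x in closedBall c r, Φ x) ^ θ * (∫⁻ x in closedBall c r, V x) ^ (1 - θ) := fun c r =>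
    ENNReal.lintegral_mul_norm_pow_le hΦw.measurable.aemeasurable hVw.measurable.aemeasurable
      hθ0.le hθ'.le (by ring)
  refine ⟨hΦw.mul_rpow hVw _ _ fun c r _ => ne_top_of_le_ne_top (ENNReal.mul_ne_top
    (ENNReal.rpow_ne_top_of_nonneg hθ0.le (hΦw.locFin c r))
    (ENNReal.rpow_ne_top_of_nonneg hθ'.le (hVw.locFin c r))) (hW c r),
    K ^ θ * K' ^ (1 - θ), ENNReal.mul_ne_top (ENNReal.rpow_ne_top_of_nonneg hθ0.le hK)
      (ENNReal.rpow_ne_top_of_nonneg hθ'.le hK'), fun c r hr => ?_⟩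
  set B := closedBall c r with hB
  set I := ∫⁻ x in B, Φ x with hI
  have hI0 : I ≠ 0 := setLIntegral_ne_zero hΦw.measurable hΦw.ne_zero c hr
  have hI1 : I ≠ ∞ := hΦw.locFin c r
  have hb0 : volume B ≠ 0 := volume_closedBall_ne_zero c hr
  have hb1 : volume B ≠ ∞ := volume_closedBall_ne_top c r
  set δ := (q - 1) * (1 - θ) with hδ
  have hδ0 : 0 < δ := by positivity
  rw [add_sub_cancel_left]
  have hdual : ∫⁻ x in B, (Φ x ^ θ * V x ^ (1 - θ)) ^ (-(1 / δ)) ≤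
      (K * volume B / I) ^ (θ / δ) * ∫⁻ x in B, V x ^ (-(1 / (q - 1))) := by
    rw [← lintegral_const_mul _ hσ.measurable]
    refine lintegral_mono_ae ?_
    filter_upwards [hKΦ c r hr (θ / δ) (by positivity), ae_restrict_of_ae hΦw.ne_zero,
      ae_restrict_of_ae hΦw.ne_top, ae_restrict_of_ae hVw.ne_zero,
      ae_restrict_of_ae hVw.ne_top] with x hx h1 h2 h3 h4
    rw [ENNReal.mul_rpow_of_ne_top (ENNReal.rpow_ne_top_of_ne_zero h1 h2)
      (ENNReal.rpow_ne_top_of_ne_zero h3 h4), ← ENNReal.rpow_mul, ← ENNReal.rpow_mul]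
    have e1 : θ * -(1 / δ) = -(θ / δ) := by ring
    have e2 : (1 - θ) * -(1 / δ) = -(1 / (q - 1)) := by rw [hδ]; field_simp
    rw [e1, e2]
    exact mul_le_mul_left hx _
  calc (∫⁻ x in B, Φ x ^ θ * V x ^ (1 - θ)) * (∫⁻ x in B, (Φ x ^ θ * V x ^ (1 - θ)) ^ (-(1 / δ))) ^ δ
      ≤ (I ^ θ * (∫⁻ x in B, V x) ^ (1 - θ)) *
        ((K * volume B / I) ^ (θ / δ) * ∫⁻ x in B, V x ^ (-(1 / (q - 1)))) ^ δ :=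
        mul_le_mul' (hW c r) (ENNReal.rpow_le_rpow hdual hδ0.le)
    _ = ((K * volume B / I) ^ θ * I ^ θ) * ((∫⁻ x in B, V x) *
        (∫⁻ x in B, V x ^ (-(1 / (q - 1)))) ^ (q - 1)) ^ (1 - θ) := by
        rw [ENNReal.mul_rpow_of_nonneg _ _ hδ0.le, ENNReal.mul_rpow_of_nonneg _ _ hθ'.le,
          ← ENNReal.rpow_mul, ← ENNReal.rpow_mul, div_mul_cancel₀ _ hδ0.ne']
        ring
    _ ≤ (K * volume B) ^ θ * (K' * volume B ^ q) ^ (1 - θ) := by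
        rw [div_rpow_mul_rpow hI0 hI1 hθ0.le]
        exact mul_le_mul_right (ENNReal.rpow_le_rpow (hKV c r hr) hθ'.le) _
    _ = K ^ θ * K' ^ (1 - θ) * volume B ^ (1 + δ) := by
        rw [ENNReal.mul_rpow_of_nonneg _ _ hθ0.le, ENNReal.mul_rpow_of_nonneg _ _ hθ'.le,
          ← ENNReal.rpow_mul]
        have e : 1 + δ = θ + q * (1 - θ) := by rw [hδ]; ring
        rw [e, ENNReal.rpow_add _ _ hb0 hb1]
        ring

lemma MuckOne.rpow_neg_mul {d : ℕ} {q β : ℝ} (hq : 1 < q) (hβ : 0 < β)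
    {Φ V : (Fin d → ℝ) → ℝ≥0∞} (hΦ : MuckOne Φ) (hV : Muck q V) :
    Muck (q + β) fun x => Φ x ^ (-β) * V x ^ (1 : ℝ) := by
  obtain ⟨K, hK, hKΦ⟩ := hΦ.rpow_neg_le
  obtain ⟨hΦw, -⟩ := hΦ
  have hσ := hV.isLocWeight_dual hq
  obtain ⟨hVw, K', hK', hKV⟩ := hV
  have hq' : 0 < q - 1 := by linarith
  have hW : ∀ c r, 0 < r → ∫⁻ x in closedBall c r, Φ x ^ (-β) * V x ^ (1 : ℝ) ≤
      (K * volume (closedBall c r) / ∫⁻ x in closedBall c r, Φ x) ^ β *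
        ∫⁻ x in closedBall c r, V x := fun c r hr => by
    rw [← lintegral_const_mul _ hVw.measurable]
    refine lintegral_mono_ae ?_
    filter_upwards [hKΦ c r hr β hβ.le] with x hx
    rw [ENNReal.rpow_one]
    exact mul_le_mul_left hx _
  refine ⟨hΦw.mul_rpow hVw _ _ fun c r hr => ne_top_of_le_ne_top (ENNReal.mul_ne_top
    (ENNReal.rpow_ne_top_of_nonneg hβ.le (ENNReal.div_ne_top (ENNReal.mul_ne_top hK
      (volume_closedBall_ne_top c r)) (setLIntegral_ne_zero hΦw.measurable hΦw.ne_zero c hr)))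
    (hVw.locFin c r)) (hW c r hr),
    K ^ β * K', ENNReal.mul_ne_top (ENNReal.rpow_ne_top_of_nonneg hβ.le hK) hK', fun c r hr => ?_⟩
  set B := closedBall c r with hB
  set I := ∫⁻ x in B, Φ x with hI
  have hI0 : I ≠ 0 := setLIntegral_ne_zero hΦw.measurable hΦw.ne_zero c hr
  have hI1 : I ≠ ∞ := hΦw.locFin c r
  have hb0 : volume B ≠ 0 := volume_closedBall_ne_zero c hr
  have hb1 : volume B ≠ ∞ := volume_closedBall_ne_top c r
  set δ := q + β - 1 with hδ
  have hδ0 : 0 < δ := by linarith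
  have hdual : ∫⁻ x in B, (Φ x ^ (-β) * V x ^ (1 : ℝ)) ^ (-(1 / δ)) ≤
      I ^ (β / δ) * (∫⁻ x in B, V x ^ (-(1 / (q - 1)))) ^ ((q - 1) / δ) := by
    refine le_trans (le_of_eq ?_) (ENNReal.lintegral_mul_norm_pow_le
      hΦw.measurable.aemeasurable hσ.measurable.aemeasurable
      (p := β / δ) (q := (q - 1) / δ) (by positivity) (by positivity) ?_)
    · refine lintegral_congr_ae (ae_restrict_of_ae ?_)
      filter_upwards [hΦw.ne_zero, hΦw.ne_top, hVw.ne_zero, hVw.ne_top] with x h1 h2 h3 h4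
      rw [ENNReal.mul_rpow_of_ne_top (ENNReal.rpow_ne_top_of_ne_zero h1 h2)
        (ENNReal.rpow_ne_top_of_ne_zero h3 h4), ← ENNReal.rpow_mul, ← ENNReal.rpow_mul,
        ← ENNReal.rpow_mul]
      have e1 : -β * -(1 / δ) = β / δ := by ring
      have e2 : (1 : ℝ) * -(1 / δ) = -(1 / (q - 1)) * ((q - 1) / δ) := by field_simp
      rw [e1, e2]
    · rw [← add_div, div_eq_one_iff_eq hδ0.ne', hδ]; ring
  calc (∫⁻ x in B, Φ x ^ (-β) * V x ^ (1 : ℝ)) *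
        (∫⁻ x in B, (Φ x ^ (-β) * V x ^ (1 : ℝ)) ^ (-(1 / δ))) ^ δ
      ≤ ((K * volume B / I) ^ β * ∫⁻ x in B, V x) *
        (I ^ (β / δ) * (∫⁻ x in B, V x ^ (-(1 / (q - 1)))) ^ ((q - 1) / δ)) ^ δ :=
        mul_le_mul' (hW c r hr) (ENNReal.rpow_le_rpow hdual hδ0.le)
    _ = ((K * volume B / I) ^ β * I ^ β) * ((∫⁻ x in B, V x) *
        (∫⁻ x in B, V x ^ (-(1 / (q - 1)))) ^ (q - 1)) := by
        rw [ENNReal.mul_rpow_of_nonneg _ _ hδ0.le, ← ENNReal.rpow_mul, ← ENNReal.rpow_mul,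
          div_mul_cancel₀ _ hδ0.ne', div_mul_cancel₀ _ hδ0.ne']
        ring
    _ ≤ (K * volume B) ^ β * (K' * volume B ^ q) := by
        rw [div_rpow_mul_rpow hI0 hI1 hβ.le]
        exact mul_le_mul_right (hKV c r hr) _
    _ = K ^ β * K' * volume B ^ (q + β) := by
        rw [ENNReal.mul_rpow_of_nonneg _ _ hβ.le, ENNReal.rpow_add _ _ hb0 hb1]
        ring

/-- The class `A_s` for `1 ≤ s`. -/
def MuckWeight {d : ℕ} (s : ℝ) (v : (Fin d → ℝ) → ℝ≥0∞) : Prop :=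
  (s = 1 ∧ MuckOne v) ∨ (1 < s ∧ Muck s v)

lemma MuckWeight.isLocWeight {d : ℕ} {s : ℝ} {v : (Fin d → ℝ) → ℝ≥0∞} (h : MuckWeight s v) :
    IsLocWeight v :=
  h.elim (fun h => h.2.1) fun h => h.2.1

/-- Lowering the exponent: a weight in `A_{q₁}` dominating `h V`, with the embedding of `L^q(V)`
into `L^{q₁}(W)`. -/
lemma Muck.exists_muckWeight_of_lt {d : ℕ} {q q₁ : ℝ} (hq₁ : 1 ≤ q₁) (hq : q₁ < q)
    {V h : (Fin d → ℝ) → ℝ≥0∞} (hV : Muck q V) (hh : Measurable h)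
    (hfin : ∫⁻ x, h x ^ (q / (q - q₁)) * V x ≠ ∞) :
    ∃ W : (Fin d → ℝ) → ℝ≥0∞, MuckWeight q₁ W ∧ (∀ᵐ x, h x * V x ≤ W x) ∧
      ∃ C : ℝ≥0∞, C ≠ ∞ ∧ ∀ F : (Fin d → ℝ) → ℝ≥0∞, Measurable F →
        ∫⁻ x, F x ^ q₁ * W x ≤ C * (∫⁻ x, F x ^ q * V x) ^ (q₁ / q) := by
  have hq0 : 1 < q := by linarith
  have hq' : 0 < q - 1 := by linarith
  have hqq : 0 < q - q₁ := by linarith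
  have hs : 1 < q / (q - 1) := by rw [lt_div_iff₀ hq']; linarith
  have hVw := hV.1
  have hσ := hV.isLocWeight_dual hq0
  set θ := (q - q₁) / (q - 1) with hθ
  have hθ0 : 0 < θ := by positivity
  have hφm : Measurable fun x => h x ^ (1 / θ) * V x := (hh.pow_const _).mul hVw.measurable
  have hφ : ∫⁻ x, (h x ^ (1 / θ) * V x) ^ (q / (q - 1)) * V x ^ (-(1 / (q - 1))) ≠ ∞ := by
    convert hfin using 1
    refine lintegral_congr_ae ?_
    filter_upwards [hVw.ne_zero, hVw.ne_top] with x h0 h1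
    have e1 : 1 / θ * (q / (q - 1)) = q / (q - q₁) := by rw [hθ]; field_simp
    have e2 : q / (q - 1) + -(1 / (q - 1)) = 1 := by field_simp; ring
    rw [ENNReal.mul_rpow_of_nonneg _ _ (by positivity), ← ENNReal.rpow_mul, e1, mul_assoc,
      ← ENNReal.rpow_add _ _ h0 h1, e2, ENNReal.rpow_one]
  obtain ⟨Φ, hΦ, hφΦ, hΦfin⟩ := (hV.dual hq0).exists_muckOne_majorant hs hφm hφ
  have hΦw := hΦ.1
  refine ⟨fun x => Φ x ^ θ * V x ^ (1 - θ), ?_, ?_,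
    (∫⁻ x, Φ x ^ (q / (q - 1)) * V x ^ (-(1 / (q - 1)))) ^ ((q - q₁) / q),
    ENNReal.rpow_ne_top_of_nonneg (by positivity) hΦfin, fun F hF => ?_⟩
  · rcases hq₁.eq_or_lt with h1 | h1
    · left
      have : θ = 1 := by rw [hθ, ← h1]; exact div_self hq'.ne'
      simpa [this, ← h1] using hΦ
    · right
      have hθ1 : θ < 1 := by rw [hθ, div_lt_one hq']; linarith
      have h2 := hΦ.rpow_mul_rpow hq0 hθ0 hθ1 hV
      have e : 1 + (q - 1) * (1 - θ) = q₁ := by rw [hθ]; field_simp; ring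
      rw [e] at h2
      exact ⟨h1, h2⟩
  · filter_upwards [hVw.ne_zero, hVw.ne_top] with x h0 h1
    have h2 := ENNReal.rpow_le_rpow (hφΦ x) hθ0.le
    rw [ENNReal.mul_rpow_of_nonneg _ _ hθ0.le, ← ENNReal.rpow_mul, one_div_mul_cancel hθ0.ne',
      ENNReal.rpow_one] at h2
    calc h x * V x = h x * V x ^ θ * V x ^ (1 - θ) := by
          rw [mul_assoc, ← ENNReal.rpow_add _ _ h0 h1, add_sub_cancel, ENNReal.rpow_one]
      _ ≤ _ := mul_le_mul_left h2 _
  · rw [mul_comm]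
    refine le_trans (le_of_eq ?_) (ENNReal.lintegral_mul_norm_pow_le
      ((hF.pow_const q).mul hVw.measurable).aemeasurable
      ((hΦw.measurable.pow_const _).mul hσ.measurable).aemeasurable
      (p := q₁ / q) (q := (q - q₁) / q) (by positivity) (by positivity) (by field_simp; ring))
    refine lintegral_congr_ae ?_
    filter_upwards [hVw.ne_zero, hVw.ne_top] with x h0 h1
    simp only [Pi.mul_apply]
    rw [ENNReal.mul_rpow_of_nonneg _ _ (by positivity),
      ENNReal.mul_rpow_of_nonneg _ _ (by positivity), ← ENNReal.rpow_mul, ← ENNReal.rpow_mul,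
      ← ENNReal.rpow_mul]
    have e1 : q * (q₁ / q) = q₁ := by field_simp
    have e2 : q / (q - 1) * ((q - q₁) / q) = θ := by rw [hθ]; field_simp
    have e3 : q₁ / q + -(1 / (q - 1)) * ((q - q₁) / q) = 1 - θ := by rw [hθ]; field_simp; ring
    rw [e1, e2, ← e3, ENNReal.rpow_add _ _ h0 h1]
    ring

/-! ### Extrapolation for families of pairs of functions -/

lemma exists_lt_two_pow {C : ℝ≥0∞} (hC : C ≠ ∞) : ∃ n : ℕ, C < 2 ^ n := by
  obtain ⟨n, hn⟩ := ENNReal.exists_nat_gt hC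
  refine ⟨n, hn.trans ?_⟩
  exact_mod_cast Nat.lt_two_pow_self

lemma IsLocWeight.exists_truncation {d : ℕ} {V : (Fin d → ℝ) → ℝ≥0∞} (hV : IsLocWeight V)
    {g : (Fin d → ℝ) → ℝ≥0∞} (hg : Measurable g) {A : ℝ≥0∞} (hA : A < ∫⁻ x, g x * V x) :
    ∃ φ : (Fin d → ℝ) → ℝ≥0∞, Measurable φ ∧ (∀ x, φ x ≤ g x) ∧ A < ∫⁻ x, φ x * V x ∧
      ∫⁻ x, φ x * V x ≠ ∞ := by
  set φ : ℕ → (Fin d → ℝ) → ℝ≥0∞ := fun m =>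
    (closedBall (0 : Fin d → ℝ) m).indicator fun x => min (g x) m with hφ
  have hφm : ∀ m, Measurable (φ m) := fun m =>
    (hg.min measurable_const).indicator measurableSet_closedBall
  have hmono : Monotone fun m x => φ m x * V x := by
    intro m n hmn x
    refine mul_le_mul_left ?_ _
    simp only [hφ]
    have hmn' : (m : ℝ) ≤ n := by exact_mod_cast hmn
    by_cases hx : x ∈ closedBall (0 : Fin d → ℝ) m
    · rw [Set.indicator_of_mem hx, Set.indicator_of_mem (closedBall_subset_closedBall hmn' hx)]
      exact min_le_min_left _ (by exact_mod_cast hmn)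
    · rw [Set.indicator_of_notMem hx]; exact zero_le
  have hsup : ∀ᵐ x, ⨆ m, φ m x * V x = g x * V x := by
    filter_upwards [hV.ne_top] with x hx
    rw [← ENNReal.iSup_mul]
    congr 1
    refine le_antisymm (iSup_le fun m => ?_) (le_of_forall_lt fun b hb => ?_)
    · exact (Set.indicator_le_self _ _ _).trans (min_le_left _ _)
    · obtain ⟨m, hm⟩ := ENNReal.exists_nat_gt (ne_top_of_lt hb)
      obtain ⟨n, hn⟩ := exists_nat_ge (dist x 0)
      refine lt_of_lt_of_le (lt_min hb hm) (le_trans ?_ (le_iSup _ (max m n)))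
      have hx : x ∈ closedBall (0 : Fin d → ℝ) ((max m n : ℕ) : ℝ) :=
        mem_closedBall.2 (hn.trans (by exact_mod_cast le_max_right m n))
      simp only [hφ, Set.indicator_of_mem hx]
      exact min_le_min_left _ (by exact_mod_cast le_max_left m n)
  have hlim : ∫⁻ x, g x * V x = ⨆ m, ∫⁻ x, φ m x * V x := by
    have hm : ∀ m, Measurable fun x => φ m x * V x := fun m => (hφm m).mul hV.measurable
    rw [← lintegral_iSup hm hmono]
    refine lintegral_congr_ae ?_
    filter_upwards [hsup] with x hx using hx.symm
  rw [hlim, lt_iSup_iff] at hA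
  obtain ⟨m, hm⟩ := hA
  refine ⟨φ m, hφm m, fun x => (Set.indicator_le_self _ _ _).trans (min_le_left _ _), hm, ?_⟩
  refine ne_top_of_le_ne_top (ENNReal.mul_ne_top (ENNReal.natCast_ne_top m) (hV.locFin 0 m)) ?_
  rw [← lintegral_const_mul _ hV.measurable, ← lintegral_indicator measurableSet_closedBall]
  refine lintegral_mono fun x => ?_
  simp only [hφ]
  by_cases hx : x ∈ closedBall (0 : Fin d → ℝ) m
  · simp only [Set.indicator_of_mem hx]
    exact mul_le_mul_left (min_le_right _ _) _
  · simp [Set.indicator_of_notMem hx]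

lemma extrapolation_of_lt {d : ℕ} {q q₁ : ℝ} (hq₁ : 1 ≤ q₁) (hq : q₁ < q) {ι : Type*}
    {F G : ι → (Fin d → ℝ) → ℝ≥0∞} (hF : ∀ i, Measurable (F i)) (hG : ∀ i, Measurable (G i))
    (h : ∀ W : (Fin d → ℝ) → ℝ≥0∞, MuckWeight q₁ W → ∃ C : ℝ≥0∞, C ≠ ∞ ∧ ∀ i,
      ∫⁻ x, G i x ^ q₁ * W x ≤ C * ∫⁻ x, F i x ^ q₁ * W x)
    {V : (Fin d → ℝ) → ℝ≥0∞} (hV : Muck q V) :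
    ∃ C : ℝ≥0∞, C ≠ ∞ ∧ ∀ i, ∫⁻ x, G i x ^ q * V x ≤ C * ∫⁻ x, F i x ^ q * V x := by
  have hq0 : 0 < q := by linarith
  by_contra! hcon
  have hVw := hV.1
  choose i hi using fun n : ℕ => hcon (((4 : ℝ≥0∞) ^ n) ^ (q / q₁))
    (ENNReal.rpow_ne_top_of_nonneg (by positivity) (ENNReal.pow_ne_top (by simp)))
  choose φ hφm hφG hφL hφfin using fun n => hVw.exists_truncation ((hG (i n)).pow_const q) (hi n)
  set L : ℕ → ℝ≥0∞ := fun n => ∫⁻ x, φ n x * V x with hL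
  have hφVm : ∀ n, Measurable fun x => φ n x * V x := fun n => (hφm n).mul hVw.measurable
  have hL0 : ∀ n, L n ≠ 0 := fun n => (pos_of_gt (hφL n)).ne'
  set a := (q - q₁) / q with ha
  have ha0 : 0 < a := by have : 0 < q - q₁ := by linarith
                         positivity
  have ha1 : a ≤ 1 := by rw [ha, div_le_one hq0]; linarith
  have ha' : q₁ / q = 1 - a := by rw [ha]; field_simp; ring
  set S : (Fin d → ℝ) → ℝ≥0∞ := fun x => ∑' n, 2⁻¹ ^ n / L n * φ n x with hS
  have hterm : ∀ n, Measurable fun x => 2⁻¹ ^ n / L n * φ n x := fun n => (hφm n).const_mul _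
  have hSm : Measurable S := Measurable.tsum hterm
  have hSfin : ∫⁻ x, (S x ^ a) ^ (q / (q - q₁)) * V x ≠ ∞ := by
    have e : a * (q / (q - q₁)) = 1 := by
      have : q - q₁ ≠ 0 := by linarith
      rw [ha]; field_simp
    have : ∫⁻ x, (S x ^ a) ^ (q / (q - q₁)) * V x ≤ 2 := by
      calc ∫⁻ x, (S x ^ a) ^ (q / (q - q₁)) * V x
          = ∫⁻ x, ∑' n, 2⁻¹ ^ n / L n * (φ n x * V x) := by
            refine lintegral_congr fun x => ?_
            rw [← ENNReal.rpow_mul, e, ENNReal.rpow_one, hS, ← ENNReal.tsum_mul_right]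
            simp only [mul_assoc]
        _ = ∑' n, 2⁻¹ ^ n / L n * L n := by
            rw [lintegral_tsum fun n => ((hφVm n).const_mul _).aemeasurable]
            exact tsum_congr fun n => lintegral_const_mul _ (hφVm n)
        _ = ∑' n, 2⁻¹ ^ n :=
            tsum_congr fun n => ENNReal.div_mul_cancel (hL0 n) (hφfin n)
        _ ≤ 2 := ENNReal.tsum_geometric_two.le
    exact ne_top_of_le_ne_top (by simp) this
  obtain ⟨W, hW, hSW, C₁, hC₁, hCF⟩ :=
    hV.exists_muckWeight_of_lt hq₁ hq (hSm.pow_const a) hSfin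
  obtain ⟨C₂, hC₂, hFG⟩ := h W hW
  obtain ⟨n, hn⟩ := exists_lt_two_pow (ENNReal.mul_ne_top hC₂ hC₁)
  set X := ∫⁻ x, F (i n) x ^ q * V x with hX
  have h1 : (2⁻¹ ^ n / L n) ^ a * L n ≤ C₂ * C₁ * X ^ (q₁ / q) := by
    calc (2⁻¹ ^ n / L n) ^ a * L n = ∫⁻ x, (2⁻¹ ^ n / L n) ^ a * (φ n x * V x) :=
          (lintegral_const_mul _ (hφVm n)).symm
      _ ≤ ∫⁻ x, G (i n) x ^ q₁ * W x := by
          refine lintegral_mono_ae ?_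
          filter_upwards [hSW] with x hx
          have e1 : φ n x ^ (q₁ / q) ≤ G (i n) x ^ q₁ := by
            refine (ENNReal.rpow_le_rpow (hφG n x) (by positivity)).trans (le_of_eq ?_)
            rw [← ENNReal.rpow_mul, mul_div_cancel₀ _ hq0.ne']
          have e2 : (2⁻¹ ^ n / L n * φ n x) ^ a ≤ S x ^ a :=
            ENNReal.rpow_le_rpow (ENNReal.le_tsum (f := fun n => 2⁻¹ ^ n / L n * φ n x) n) ha0.le
          calc (2⁻¹ ^ n / L n) ^ a * (φ n x * V x)
              = φ n x ^ (q₁ / q) * ((2⁻¹ ^ n / L n * φ n x) ^ a * V x) := by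
                have e3 : φ n x = φ n x ^ (q₁ / q) * φ n x ^ a := by
                  rw [← ENNReal.rpow_add_of_nonneg _ _ (by positivity) ha0.le, ha',
                    sub_add_cancel, ENNReal.rpow_one]
                rw [ENNReal.mul_rpow_of_nonneg _ _ ha0.le]
                nth_rewrite 1 [e3]
                ring
            _ ≤ G (i n) x ^ q₁ * W x :=
                mul_le_mul' e1 ((mul_le_mul_left e2 _).trans hx)
      _ ≤ C₂ * ∫⁻ x, F (i n) x ^ q₁ * W x := hFG _
      _ ≤ C₂ * (C₁ * X ^ (q₁ / q)) := mul_le_mul_right (hCF _ (hF _)) _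
      _ = _ := (mul_assoc _ _ _).symm
  have h2 : 4 ^ n * X ^ (q₁ / q) ≤ L n ^ (q₁ / q) := by
    have h3 := ENNReal.rpow_le_rpow (hφL n).le (z := q₁ / q) (by positivity)
    rwa [ENNReal.mul_rpow_of_nonneg _ _ (by positivity), ← ENNReal.rpow_mul,
      div_mul_div_cancel₀ (by linarith), div_self hq0.ne', ENNReal.rpow_one] at h3
  have hLp0 : L n ^ (q₁ / q) ≠ 0 :=
    (ENNReal.rpow_pos (pos_iff_ne_zero.2 (hL0 n)) (hφfin n)).ne'
  have hLp1 : L n ^ (q₁ / q) ≠ ∞ := ENNReal.rpow_ne_top_of_nonneg (by positivity) (hφfin n)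
  have h3 : 2 ^ n * L n ^ (q₁ / q) ≤ C₂ * C₁ * L n ^ (q₁ / q) := by
    calc 2 ^ n * L n ^ (q₁ / q) = 4 ^ n * (2⁻¹ ^ n * L n ^ (q₁ / q)) := by
          rw [← mul_assoc, ← mul_pow]
          congr 2
          rw [show (4 : ℝ≥0∞) = 2 * 2 by norm_num, mul_assoc,
            ENNReal.mul_inv_cancel (by simp) (by simp), mul_one]
      _ ≤ 4 ^ n * ((2⁻¹ ^ n) ^ a * L n ^ (q₁ / q)) := by
          refine mul_le_mul_right (mul_le_mul_left ?_ _) _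
          have : (2⁻¹ : ℝ≥0∞) ^ n ≤ 1 := pow_le_one' (by simp) n
          simpa using ENNReal.rpow_le_rpow_of_exponent_ge this ha1
      _ = 4 ^ n * ((2⁻¹ ^ n / L n) ^ a * L n) := by
          congr 1
          have e3 : L n = L n ^ a * L n ^ (q₁ / q) := by
            rw [← ENNReal.rpow_add _ _ (hL0 n) (hφfin n), ha', add_sub_cancel, ENNReal.rpow_one]
          nth_rewrite 3 [e3]
          rw [← mul_assoc, div_rpow_mul_rpow (hL0 n) (hφfin n) ha0.le]
      _ ≤ 4 ^ n * (C₂ * C₁ * X ^ (q₁ / q)) := mul_le_mul_right h1 _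
      _ = C₂ * C₁ * (4 ^ n * X ^ (q₁ / q)) := by ring
      _ ≤ _ := mul_le_mul_right h2 _
  exact absurd ((ENNReal.mul_le_mul_iff_left hLp0 hLp1).1 h3) (not_le.2 hn)

lemma extrapolation_of_gt {d : ℕ} {q q₁ : ℝ} (hq : 1 < q) (hq₁ : q < q₁) {ι : Type*}
    {F G : ι → (Fin d → ℝ) → ℝ≥0∞} (hF : ∀ i, Measurable (F i)) (hG : ∀ i, Measurable (G i))
    (h : ∀ W : (Fin d → ℝ) → ℝ≥0∞, MuckWeight q₁ W → ∃ C : ℝ≥0∞, C ≠ ∞ ∧ ∀ i,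
      ∫⁻ x, G i x ^ q₁ * W x ≤ C * ∫⁻ x, F i x ^ q₁ * W x)
    {V : (Fin d → ℝ) → ℝ≥0∞} (hV : Muck q V) :
    ∃ C : ℝ≥0∞, C ≠ ∞ ∧ ∀ i, ∫⁻ x, G i x ^ q * V x ≤ C * ∫⁻ x, F i x ^ q * V x := by
  have hq0 : 0 < q := by linarith
  have hq₁0 : 0 < q₁ := by linarith
  have hqq : 0 < q₁ - q := by linarith
  by_contra! hcon
  have hVw := hV.1
  choose i hi using fun n : ℕ => hcon ((4 : ℝ≥0∞) ^ n) (ENNReal.pow_ne_top (by simp))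
  set X : ℕ → ℝ≥0∞ := fun n => ∫⁻ x, F (i n) x ^ q * V x with hX
  have hX1 : ∀ n, X n ≠ ∞ := fun n htop => by
    have := hi n
    simp only [hX] at htop
    rw [htop, ENNReal.mul_top (by simp)] at this
    exact not_top_lt this
  have hFqm : ∀ n, Measurable fun x => F (i n) x ^ q := fun n => (hF _).pow_const q
  have hFVm : ∀ n, Measurable fun x => F (i n) x ^ q * V x := fun n =>
    (hFqm n).mul hVw.measurable
  set S : (Fin d → ℝ) → ℝ≥0∞ := fun x => ∑' n, 2⁻¹ ^ n / X n * F (i n) x ^ q with hS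
  have hSm : Measurable S := Measurable.tsum fun n => (hFqm n).const_mul _
  have hSfin : ∫⁻ x, (S x ^ (1 / q)) ^ q * V x ≠ ∞ := by
    have : ∫⁻ x, (S x ^ (1 / q)) ^ q * V x ≤ 2 := by
      calc ∫⁻ x, (S x ^ (1 / q)) ^ q * V x
          = ∫⁻ x, ∑' n, 2⁻¹ ^ n / X n * (F (i n) x ^ q * V x) := by
            refine lintegral_congr fun x => ?_
            rw [← ENNReal.rpow_mul, one_div_mul_cancel hq0.ne', ENNReal.rpow_one, hS,
              ← ENNReal.tsum_mul_right]
            simp only [mul_assoc]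
        _ = ∑' n, 2⁻¹ ^ n / X n * X n := by
            rw [lintegral_tsum fun n => ((hFVm n).const_mul _).aemeasurable]
            exact tsum_congr fun n => lintegral_const_mul _ (hFVm n)
        _ ≤ ∑' n, 2⁻¹ ^ n := ENNReal.tsum_le_tsum fun n => by
            rw [div_eq_mul_inv, mul_assoc]
            exact mul_le_of_le_one_right' (ENNReal.inv_mul_le_one _)
        _ ≤ 2 := ENNReal.tsum_geometric_two.le
    exact ne_top_of_le_ne_top (by simp) this
  obtain ⟨H, hH, hSH, hHfin⟩ := hV.exists_muckOne_majorant hq (hSm.pow_const (1 / q)) hSfin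
  have hHw := hH.1
  set Z := ∫⁻ x, H x ^ q * V x with hZ
  have hW := hH.rpow_neg_mul hq hqq hV
  rw [add_sub_cancel] at hW
  obtain ⟨C, hC, hFG⟩ := h _ (.inr ⟨by linarith, hW⟩)
  have hZ' : Z ^ ((q₁ - q) / q₁) ≠ ∞ := ENNReal.rpow_ne_top_of_nonneg (by positivity) hHfin
  obtain ⟨n, hn⟩ := exists_lt_two_pow (ENNReal.mul_ne_top
    (ENNReal.rpow_ne_top_of_nonneg (x := C) (y := q / q₁) (by positivity) hC) hZ')
  have hFH : ∀ᵐ x, F (i n) x ^ q ≤ 2 ^ n * X n * H x ^ q := by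
    by_cases hX0 : X n = 0
    · have h0 : ∫⁻ x, F (i n) x ^ q * V x = 0 := hX0
      rw [lintegral_eq_zero_iff (hFVm n)] at h0
      filter_upwards [h0, hVw.ne_zero] with x hx hx0
      have : F (i n) x ^ q = 0 := (mul_eq_zero.1 hx).resolve_right hx0
      rw [this]; exact zero_le
    · refine .of_forall fun x => ?_
      have h1 : 2⁻¹ ^ n / X n * F (i n) x ^ q ≤ H x ^ q := by
        refine (ENNReal.le_tsum (f := fun n => 2⁻¹ ^ n / X n * F (i n) x ^ q) n).trans ?_
        have := ENNReal.rpow_le_rpow (hSH x) hq0.le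
        rwa [← ENNReal.rpow_mul, one_div_mul_cancel hq0.ne', ENNReal.rpow_one] at this
      calc F (i n) x ^ q = 2 ^ n * X n * (2⁻¹ ^ n / X n * F (i n) x ^ q) := by
            have e1 : (2 : ℝ≥0∞) ^ n * 2⁻¹ ^ n = 1 := by
              rw [← mul_pow, ENNReal.mul_inv_cancel (by simp) (by simp), one_pow]
            calc F (i n) x ^ q = (2 ^ n * 2⁻¹ ^ n) * (X n * (X n)⁻¹) * F (i n) x ^ q := by
                  rw [e1, ENNReal.mul_inv_cancel hX0 (hX1 n), one_mul, one_mul]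
              _ = _ := by rw [div_eq_mul_inv]; ring
        _ ≤ _ := mul_le_mul_right h1 _
  have hFW : ∫⁻ x, F (i n) x ^ q₁ * (H x ^ (-(q₁ - q)) * V x ^ (1 : ℝ)) ≤
      (2 ^ n * X n) ^ ((q₁ - q) / q) * X n := by
    rw [← lintegral_const_mul _ (hFVm n)]
    refine lintegral_mono_ae ?_
    filter_upwards [hFH, hHw.ne_zero, hHw.ne_top] with x hx h0 h1
    have h2 := ENNReal.rpow_le_rpow hx (z := (q₁ - q) / q) (by positivity)
    rw [ENNReal.mul_rpow_of_nonneg _ _ (by positivity), ← ENNReal.rpow_mul, ← ENNReal.rpow_mul,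
      mul_div_cancel₀ _ hq0.ne'] at h2
    have e1 : F (i n) x ^ q₁ = F (i n) x ^ (q₁ - q) * F (i n) x ^ q := by
      rw [← ENNReal.rpow_add_of_nonneg _ _ hqq.le hq0.le, sub_add_cancel]
    have e2 : H x ^ (q₁ - q) * H x ^ (-(q₁ - q)) = 1 := by
      rw [← ENNReal.rpow_add _ _ h0 h1, add_neg_cancel, ENNReal.rpow_zero]
    calc F (i n) x ^ q₁ * (H x ^ (-(q₁ - q)) * V x ^ (1 : ℝ))
        = F (i n) x ^ (q₁ - q) * (H x ^ (-(q₁ - q)) * (F (i n) x ^ q * V x)) := by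
          rw [e1, ENNReal.rpow_one]; ring
      _ ≤ ((2 ^ n * X n) ^ ((q₁ - q) / q) * H x ^ (q₁ - q)) *
          (H x ^ (-(q₁ - q)) * (F (i n) x ^ q * V x)) := mul_le_mul_left h2 _
      _ = (2 ^ n * X n) ^ ((q₁ - q) / q) * (H x ^ (q₁ - q) * H x ^ (-(q₁ - q))) *
          (F (i n) x ^ q * V x) := by ring
      _ = _ := by rw [e2, mul_one]
  have hY : ∫⁻ x, G (i n) x ^ q * V x ≤
      (∫⁻ x, G (i n) x ^ q₁ * (H x ^ (-(q₁ - q)) * V x ^ (1 : ℝ))) ^ (q / q₁) *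
        Z ^ ((q₁ - q) / q₁) := by
    refine le_trans (le_of_eq ?_) (ENNReal.lintegral_mul_norm_pow_le
      (((hG _).pow_const _).mul hW.1.measurable).aemeasurable
      ((hHw.measurable.pow_const _).mul hVw.measurable).aemeasurable
      (p := q / q₁) (q := (q₁ - q) / q₁) (by positivity) (by positivity) (by field_simp; ring))
    refine lintegral_congr_ae ?_
    filter_upwards [hVw.ne_zero, hVw.ne_top, hHw.ne_zero, hHw.ne_top] with x h0 h1 h2 h3
    simp only [Pi.mul_apply, ENNReal.rpow_one]
    rw [ENNReal.mul_rpow_of_nonneg _ _ (by positivity),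
      ENNReal.mul_rpow_of_nonneg _ _ (by positivity),
      ENNReal.mul_rpow_of_nonneg _ _ (by positivity), ← ENNReal.rpow_mul, ← ENNReal.rpow_mul,
      ← ENNReal.rpow_mul, mul_div_cancel₀ _ hq₁0.ne']
    calc G (i n) x ^ q * V x = G (i n) x ^ q * (H x ^ (-(q₁ - q) * (q / q₁)) *
          H x ^ (q * ((q₁ - q) / q₁))) * (V x ^ (q / q₁) * V x ^ ((q₁ - q) / q₁)) := by
          rw [← ENNReal.rpow_add _ _ h2 h3, ← ENNReal.rpow_add _ _ h0 h1]
          have e1 : -(q₁ - q) * (q / q₁) + q * ((q₁ - q) / q₁) = 0 := by ring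
          have e2 : q / q₁ + (q₁ - q) / q₁ = 1 := by field_simp; ring
          rw [e1, e2, ENNReal.rpow_zero, mul_one, ENNReal.rpow_one]
      _ = _ := by ring
  have hfinal : 4 ^ n * X n < C ^ (q / q₁) * Z ^ ((q₁ - q) / q₁) * (2 ^ n * X n) := by
    refine (hi n).trans_le (hY.trans ?_)
    calc _ ≤ (C * ((2 ^ n * X n) ^ ((q₁ - q) / q) * X n)) ^ (q / q₁) * Z ^ ((q₁ - q) / q₁) :=
          mul_le_mul_left (ENNReal.rpow_le_rpow ((hFG _).trans (mul_le_mul_right hFW _))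
            (by positivity)) _
      _ ≤ (C * ((2 ^ n * X n) ^ ((q₁ - q) / q) * (2 ^ n * X n))) ^ (q / q₁) *
          Z ^ ((q₁ - q) / q₁) := by
          refine mul_le_mul_left (ENNReal.rpow_le_rpow (mul_le_mul_right (mul_le_mul_right ?_ _) _)
            (by positivity)) _
          exact le_mul_of_one_le_left' (one_le_pow₀ (by norm_num))
      _ = _ := by
          rw [ENNReal.mul_rpow_of_nonneg _ _ (by positivity)]
          nth_rewrite 2 [← ENNReal.rpow_one (2 ^ n * X n)]
          rw [← ENNReal.rpow_add_of_nonneg _ _ (by positivity) zero_le_one, ← ENNReal.rpow_mul]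
          have e : ((q₁ - q) / q + 1) * (q / q₁) = 1 := by field_simp; ring
          rw [e, ENNReal.rpow_one]; ring
  refine absurd hfinal (not_lt.2 ?_)
  calc C ^ (q / q₁) * Z ^ ((q₁ - q) / q₁) * (2 ^ n * X n) ≤ 2 ^ n * (2 ^ n * X n) :=
        mul_le_mul_left hn.le _
    _ = 4 ^ n * X n := by rw [← mul_assoc, ← mul_pow]; norm_num

/-- Rubio de Francia extrapolation for families of pairs of functions. -/
lemma extrapolation {d : ℕ} {q q₁ : ℝ} (hq₁ : 1 ≤ q₁) {ι : Type*}
    {F G : ι → (Fin d → ℝ) → ℝ≥0∞} (hF : ∀ i, Measurable (F i)) (hG : ∀ i, Measurable (G i))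
    (h : ∀ W : (Fin d → ℝ) → ℝ≥0∞, MuckWeight q₁ W → ∃ C : ℝ≥0∞, C ≠ ∞ ∧ ∀ i,
      ∫⁻ x, G i x ^ q₁ * W x ≤ C * ∫⁻ x, F i x ^ q₁ * W x)
    (hq : 1 < q ∨ q = q₁) {V : (Fin d → ℝ) → ℝ≥0∞} (hV : MuckWeight q V) :
    ∃ C : ℝ≥0∞, C ≠ ∞ ∧ ∀ i, ∫⁻ x, G i x ^ q * V x ≤ C * ∫⁻ x, F i x ^ q * V x := by
  rcases eq_or_ne q q₁ with rfl | hne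
  · exact h V hV
  · have hq1 := hq.resolve_right hne
    rcases hV with ⟨h1, -⟩ | ⟨-, hV⟩
    · exact absurd h1 hq1.ne'
    rcases hne.lt_or_gt with hlt | hgt
    · exact extrapolation_of_gt hq1 hlt hF hG h hV
    · exact extrapolation_of_lt hq₁ hgt hF hG h hV

/-! ### Weights adapted to a cube -/

/-- The function `∑ ρᵏ 1_{2ᵏB}` attached to the closed ball `B` with centre `c` and radius `r`. -/
def bump {d : ℕ} (ρ : ℝ≥0∞) (c : Fin d → ℝ) (r : ℝ) (x : Fin d → ℝ) : ℝ≥0∞ :=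
  ∑' k : ℕ, ρ ^ k * (closedBall c (2 ^ k * r)).indicator (fun _ => 1) x

lemma measurable_bump {d : ℕ} (ρ : ℝ≥0∞) (c : Fin d → ℝ) (r : ℝ) : Measurable (bump ρ c r) :=
  Measurable.tsum fun _ => (measurable_const.indicator measurableSet_closedBall).const_mul _

lemma pow_le_bump {d : ℕ} (ρ : ℝ≥0∞) {c x : Fin d → ℝ} {r : ℝ} {k : ℕ}
    (hx : x ∈ closedBall c (2 ^ k * r)) : ρ ^ k ≤ bump ρ c r x := by
  refine le_trans (le_of_eq ?_) (ENNReal.le_tsum k)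
  rw [Set.indicator_of_mem hx, mul_one]

lemma exists_le_two_pow_mul {r : ℝ} (hr : 0 < r) (t : ℝ) :
    ∃ k : ℕ, t ≤ 2 ^ k * r := by
  obtain ⟨k, hk⟩ := pow_unbounded_of_one_lt (t / r) (one_lt_two)
  exact ⟨k, ((div_lt_iff₀ hr).1 hk).le⟩

lemma lintegral_mul_bump {d : ℕ} (ρ : ℝ≥0∞) (c : Fin d → ℝ) (r : ℝ) (μ : Measure (Fin d → ℝ))
    {ψ : (Fin d → ℝ) → ℝ≥0∞} (hψ : Measurable ψ) :
    ∫⁻ x, ψ x * bump ρ c r x ∂μ = ∑' k : ℕ, ρ ^ k * ∫⁻ x in closedBall c (2 ^ k * r), ψ x ∂μ := by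
  have h : ∀ x, ψ x * bump ρ c r x =
      ∑' k : ℕ, ρ ^ k * (closedBall c (2 ^ k * r)).indicator ψ x := by
    intro x
    rw [bump, ← ENNReal.tsum_mul_left]
    refine tsum_congr fun k => ?_
    by_cases hx : x ∈ closedBall c (2 ^ k * r)
    · simp only [Set.indicator_of_mem hx]; ring
    · simp only [Set.indicator_of_notMem hx]; ring
  simp only [h]
  rw [lintegral_tsum fun k =>
    ((hψ.indicator measurableSet_closedBall).const_mul _).aemeasurable]
  refine tsum_congr fun k => ?_
  rw [lintegral_const_mul _ (hψ.indicator measurableSet_closedBall),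
    lintegral_indicator measurableSet_closedBall]

lemma tsum_rpow_le {τ : ℝ} (hτ0 : 0 < τ) (hτ1 : τ ≤ 1) (a : ℕ → ℝ≥0∞) :
    (∑' k, a k) ^ τ ≤ ∑' k, a k ^ τ := by
  rw [← ENNReal.le_rpow_inv_iff hτ0, ENNReal.tsum_eq_iSup_sum]
  refine iSup_le fun s => ?_
  rw [ENNReal.le_rpow_inv_iff hτ0]
  refine le_trans (Finset.le_sum_of_subadditive (fun b : ℝ≥0∞ => b ^ τ) ?_ ?_ s a)
    (ENNReal.sum_le_tsum s)
  · simp [ENNReal.zero_rpow_of_pos hτ0]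
  · exact fun x y => ENNReal.rpow_add_le_add_rpow x y hτ0.le hτ1

lemma bump_rpow_le {d : ℕ} {τ : ℝ} (hτ0 : 0 < τ) (hτ1 : τ ≤ 1) (ρ : ℝ≥0∞) (c : Fin d → ℝ) (r : ℝ)
    (x : Fin d → ℝ) : bump ρ c r x ^ τ ≤ bump (ρ ^ τ) c r x := by
  refine (tsum_rpow_le hτ0 hτ1 _).trans (ENNReal.tsum_le_tsum fun k => ?_)
  rw [ENNReal.mul_rpow_of_nonneg _ _ hτ0.le, ← ENNReal.rpow_natCast, ← ENNReal.rpow_natCast,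
    ← ENNReal.rpow_mul, ← ENNReal.rpow_mul, mul_comm (k : ℝ)]
  refine mul_le_mul_right ?_ _
  by_cases hx : x ∈ closedBall c (2 ^ k * r)
  · simp [Set.indicator_of_mem hx]
  · simp [Set.indicator_of_notMem hx, ENNReal.zero_rpow_of_pos hτ0]

/-- The volume of the intersection of a small dilate with a ball reaching out of the large one. -/
lemma volume_inter_le {d : ℕ} {c b x : Fin d → ℝ} {R s : ℝ} (hR : 0 < R) (hs : 0 < s)
    (hx : x ∈ closedBall b s) (h : R / 2 < max s (dist x c)) {m : ℕ} (hm : 1 ≤ m) :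
    volume (closedBall b s ∩ closedBall c (R / 2 ^ m)) ≤
      8 ^ d * ((2 ^ d)⁻¹) ^ m * volume (closedBall b s) := by
  have e8 : ∀ m : ℕ, (8 : ℝ≥0∞) ^ d * ((2 ^ d)⁻¹) ^ m = ENNReal.ofReal (8 / 2 ^ m) ^ d := by
    intro m
    rw [ENNReal.ofReal_div_of_pos (by positivity), div_eq_mul_inv, mul_pow, ENNReal.inv_pow,
      ENNReal.ofReal_pow (by norm_num), ENNReal.inv_pow, ← pow_mul, ← pow_mul, mul_comm m d]
    norm_num
  rw [e8]
  rcases le_or_gt R (8 * s) with h8 | h8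
  · refine (measure_mono Set.inter_subset_right).trans ?_
    have : R / 2 ^ m = (R / 2 ^ m / s) * s := by field_simp
    rw [this, volume_closedBall_mul c b (by positivity) hs.le]
    refine mul_le_mul_left (pow_le_pow_left' (ENNReal.ofReal_le_ofReal ?_) _) _
    rw [div_div, mul_comm, ← div_div]
    gcongr
    rwa [div_le_iff₀ hs]
  · rcases hm.eq_or_lt with rfl | hm
    · refine (measure_mono Set.inter_subset_left).trans ?_
      refine le_mul_of_one_le_left' (one_le_pow₀ ?_)
      rw [ENNReal.one_le_ofReal]; norm_num
    · have hd : R / 2 < dist x c := by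
        rcases lt_max_iff.1 h with h | h
        · linarith
        · exact h
      have : closedBall b s ∩ closedBall c (R / 2 ^ m) = ∅ := by
        rw [Set.eq_empty_iff_forall_notMem]
        rintro y ⟨hy1, hy2⟩
        rw [mem_closedBall] at hx hy1 hy2
        have h2 : R / 2 ^ m ≤ R / 4 := by
          have : (2 : ℝ) ^ 2 ≤ 2 ^ m := pow_le_pow_right₀ (by norm_num) hm
          gcongr; linarith
        have h3 := dist_triangle x b y
        have h4 := dist_triangle x y c
        rw [dist_comm b y] at h3
        linarith
      rw [this, measure_empty]
      exact zero_le

/-- The functions `bump` are uniformly in `A_1`. -/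
lemma setLIntegral_bump_le (d : ℕ) {ρ : ℝ≥0∞} (hρ0 : ρ ≠ 0) (hρ1 : ρ < 1)
    (hρd : ((2 : ℝ≥0∞) ^ d)⁻¹ / ρ < 1) : ∃ C : ℝ≥0∞, C ≠ ∞ ∧ ∀ (c : Fin d → ℝ) (r : ℝ), 0 < r →
    ∀ (b : Fin d → ℝ) (s : ℝ), 0 < s → ∀ x ∈ closedBall b s,
      ∫⁻ y in closedBall b s, bump ρ c r y ≤ C * volume (closedBall b s) * bump ρ c r x := by
  set η := max ρ (((2 : ℝ≥0∞) ^ d)⁻¹ / ρ) with hη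
  have hη1 : η < 1 := max_lt hρ1 hρd
  have hρt : ρ ≠ ∞ := (hρ1.trans one_lt_top).ne
  refine ⟨8 ^ d * ∑' k : ℤ, η ^ k.natAbs, ENNReal.mul_ne_top (by simp)
    (tsum_two_sided_geometric_ne_top hη1), fun c r hr b s hs x hx => ?_⟩
  have hex := exists_le_two_pow_mul hr (max s (dist x c))
  classical
  set k₁ := Nat.find hex with hk₁
  have hk₁s : max s (dist x c) ≤ 2 ^ k₁ * r := Nat.find_spec hex
  have hxb : ρ ^ k₁ ≤ bump ρ c r x :=
    pow_le_bump ρ (by rw [mem_closedBall]; exact (le_max_right _ _).trans hk₁s)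
  have hterm : ∀ k : ℕ, ρ ^ k * volume (closedBall b s ∩ closedBall c (2 ^ k * r)) ≤
      8 ^ d * volume (closedBall b s) * ρ ^ k₁ * η ^ ((k : ℤ) - k₁).natAbs := by
    intro k
    have h8 : (1 : ℝ≥0∞) ≤ 8 ^ d := one_le_pow₀ (by norm_num)
    rcases le_or_gt k₁ k with hk | hk
    · obtain ⟨m, hm⟩ := Nat.exists_eq_add_of_le hk
      have e : ((k : ℤ) - k₁).natAbs = m := by omega
      rw [e, hm, pow_add]
      calc ρ ^ k₁ * ρ ^ m * volume (closedBall b s ∩ closedBall c (2 ^ (k₁ + m) * r))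
          ≤ ρ ^ k₁ * η ^ m * volume (closedBall b s) :=
            mul_le_mul' (mul_le_mul_right (pow_le_pow_left' (le_max_left _ _) _) _)
              (measure_mono Set.inter_subset_left)
        _ ≤ 8 ^ d * (ρ ^ k₁ * η ^ m * volume (closedBall b s)) := le_mul_of_one_le_left' h8
        _ = _ := by ring
    · obtain ⟨m, hm⟩ := Nat.exists_eq_add_of_le hk.le
      have hm1 : 1 ≤ m := by omega
      have e : ((k : ℤ) - k₁).natAbs = m := by omega
      have hmin : ¬ max s (dist x c) ≤ 2 ^ (k₁ - 1) * r := Nat.find_min hex (by omega)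
      have hR : (2 : ℝ) ^ k₁ * r / 2 = 2 ^ (k₁ - 1) * r := by
        obtain ⟨j, hj⟩ : ∃ j, k₁ = j + 1 := ⟨k₁ - 1, by omega⟩
        rw [hj, Nat.add_sub_cancel, pow_succ]; ring
      have hRk : (2 : ℝ) ^ k * r = 2 ^ k₁ * r / 2 ^ m := by
        rw [hm, pow_add]; field_simp
      have hv := volume_inter_le (c := c) (b := b) (x := x) (R := 2 ^ k₁ * r) (by positivity) hs hx
        (by rw [hR]; exact not_le.1 hmin) hm1
      rw [e, hRk]
      calc ρ ^ k * volume (closedBall b s ∩ closedBall c (2 ^ k₁ * r / 2 ^ m))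
          ≤ ρ ^ k * (8 ^ d * ((2 ^ d)⁻¹) ^ m * volume (closedBall b s)) := mul_le_mul_right hv _
        _ = 8 ^ d * volume (closedBall b s) * ρ ^ k₁ * (((2 : ℝ≥0∞) ^ d)⁻¹ / ρ) ^ m := by
            have : ρ ^ k = ρ ^ k₁ * (ρ⁻¹) ^ m := by
              rw [hm, pow_add, mul_assoc, ← mul_pow, ENNReal.mul_inv_cancel hρ0 hρt, one_pow,
                mul_one]
            rw [this, div_eq_mul_inv, mul_pow]; ring
        _ ≤ _ := mul_le_mul_right (pow_le_pow_left' (le_max_right _ _) _) _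
  have e1 : ∫⁻ y in closedBall b s, bump ρ c r y =
      ∑' k : ℕ, ρ ^ k * volume (closedBall b s ∩ closedBall c (2 ^ k * r)) := by
    have := lintegral_mul_bump ρ c r (volume.restrict (closedBall b s))
      (measurable_const (a := (1 : ℝ≥0∞)))
    simp only [one_mul] at this
    rw [this]
    refine tsum_congr fun k => ?_
    rw [setLIntegral_const, one_mul, Measure.restrict_apply measurableSet_closedBall,
      Set.inter_comm]
  calc ∫⁻ y in closedBall b s, bump ρ c r y
      = ∑' k : ℕ, ρ ^ k * volume (closedBall b s ∩ closedBall c (2 ^ k * r)) := e1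
    _ ≤ ∑' k : ℕ, 8 ^ d * volume (closedBall b s) * ρ ^ k₁ * η ^ ((k : ℤ) - k₁).natAbs :=
        ENNReal.tsum_le_tsum hterm
    _ = 8 ^ d * volume (closedBall b s) * ρ ^ k₁ * ∑' k : ℕ, η ^ ((k : ℤ) - k₁).natAbs :=
        ENNReal.tsum_mul_left
    _ ≤ 8 ^ d * volume (closedBall b s) * bump ρ c r x * ∑' k : ℤ, η ^ k.natAbs :=
        mul_le_mul' (mul_le_mul_right hxb _) (ENNReal.tsum_comp_le_tsum_of_injective
          (f := fun k : ℕ => (k : ℤ) - k₁) (fun a b h => by simpa using h)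
          (fun k : ℤ => η ^ k.natAbs))
    _ = _ := by ring

/-- A reverse Hölder weight times a small power of `bump` is controlled by its pointwise value. -/
lemma setLIntegral_mul_bump_rpow_le {d : ℕ} {σ : ℝ} (hσ : 1 < σ) {w : (Fin d → ℝ) → ℝ≥0∞}
    (hw : Measurable w) {K : ℝ≥0∞} (hK : ∀ c r, 0 < r → (∫⁻ x in closedBall c r, w x ^ σ) ^ (1 / σ) ≤
      K * volume (closedBall c r) ^ (1 / σ - 1) * ∫⁻ x in closedBall c r, w x)
    {C ρ : ℝ≥0∞} {c : Fin d → ℝ} {r : ℝ}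
    (hC : ∀ (b : Fin d → ℝ) (s : ℝ), 0 < s → ∀ x ∈ closedBall b s,
      ∫⁻ y in closedBall b s, bump ρ c r y ≤ C * volume (closedBall b s) * bump ρ c r x)
    (b : Fin d → ℝ) {s : ℝ} (hs : 0 < s) {x : Fin d → ℝ} (hx : x ∈ closedBall b s) :
    ∫⁻ y in closedBall b s, w y * bump ρ c r y ^ (1 - 1 / σ) ≤
      K * C ^ (1 - 1 / σ) * (∫⁻ y in closedBall b s, w y) * bump ρ c r x ^ (1 - 1 / σ) := by
  have hσ0 : 0 < σ := by linarith
  have hτ : 0 ≤ 1 - 1 / σ := by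
    rw [sub_nonneg, div_le_one hσ0]; exact hσ.le
  set B := closedBall b s with hB
  have hH := ENNReal.lintegral_mul_norm_pow_le (μ := volume.restrict B)
    (f := fun y => w y ^ σ) (g := bump ρ c r) (p := 1 / σ) (q := 1 - 1 / σ)
    (hw.pow_const _).aemeasurable (measurable_bump ρ c r).aemeasurable (by positivity) hτ (by ring)
  have e1 : ∀ y, (w y ^ σ) ^ (1 / σ) = w y := fun y => by
    rw [← ENNReal.rpow_mul, mul_one_div_cancel hσ0.ne', ENNReal.rpow_one]
  simp only [e1] at hH
  have hV0 := volume_closedBall_ne_zero b hs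
  have hV1 := volume_closedBall_ne_top b s
  calc ∫⁻ y in B, w y * bump ρ c r y ^ (1 - 1 / σ)
      ≤ (∫⁻ y in B, w y ^ σ) ^ (1 / σ) * (∫⁻ y in B, bump ρ c r y) ^ (1 - 1 / σ) := hH
    _ ≤ (K * volume B ^ (1 / σ - 1) * ∫⁻ y in B, w y) *
          (C * volume B * bump ρ c r x) ^ (1 - 1 / σ) :=
        mul_le_mul' (hK b s hs) (ENNReal.rpow_le_rpow (hC b s hs x hx) hτ)
    _ = K * C ^ (1 - 1 / σ) * (∫⁻ y in B, w y) * bump ρ c r x ^ (1 - 1 / σ) *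
          (volume B ^ (1 / σ - 1) * volume B ^ (1 - 1 / σ)) := by
        rw [ENNReal.mul_rpow_of_nonneg _ _ hτ, ENNReal.mul_rpow_of_nonneg _ _ hτ]; ring
    _ = _ := by
        rw [← ENNReal.rpow_add _ _ hV0 hV1]
        have : 1 / σ - 1 + (1 - 1 / σ) = 0 := by ring
        rw [this, ENNReal.rpow_zero, mul_one]

/-- Pairing a function of Morrey growth `ν` with a power of `bump`. -/
lemma lintegral_mul_bump_rpow_le {d : ℕ} {τ ν : ℝ} (hτ0 : 0 < τ) (hτ1 : τ ≤ 1) (hν : 0 ≤ ν)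
    (ρ : ℝ≥0∞) {ψ : (Fin d → ℝ) → ℝ≥0∞} (hψ : Measurable ψ) {N : ℝ≥0∞}
    (hN : ∀ c r, 0 < r → ∫⁻ x in closedBall c r, ψ x ≤ N * volume (closedBall c r) ^ ν)
    (c : Fin d → ℝ) {r : ℝ} (hr : 0 < r) :
    ∫⁻ x, ψ x * bump ρ c r x ^ τ ≤
      (∑' k : ℕ, (ρ ^ τ * (2 : ℝ≥0∞) ^ (d * ν)) ^ k) * N * volume (closedBall c r) ^ ν := by
  calc ∫⁻ x, ψ x * bump ρ c r x ^ τ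
      ≤ ∫⁻ x, ψ x * bump (ρ ^ τ) c r x :=
        lintegral_mono fun x => mul_le_mul_right (bump_rpow_le hτ0 hτ1 ρ c r x) _
    _ = ∑' k : ℕ, (ρ ^ τ) ^ k * ∫⁻ x in closedBall c (2 ^ k * r), ψ x :=
        lintegral_mul_bump _ _ _ _ hψ
    _ ≤ ∑' k : ℕ, (ρ ^ τ * (2 : ℝ≥0∞) ^ (d * ν)) ^ k * (N * volume (closedBall c r) ^ ν) := by
        refine ENNReal.tsum_le_tsum fun k => ?_
        refine (mul_le_mul_right (hN c _ (by positivity)) _).trans (le_of_eq ?_)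
        rw [volume_closedBall_mul c c (by positivity) hr.le, ENNReal.mul_rpow_of_nonneg _ _ hν,
          mul_pow]
        have : (ENNReal.ofReal (2 ^ k) ^ d) ^ ν = ((2 : ℝ≥0∞) ^ (d * ν)) ^ k := by
          rw [ENNReal.ofReal_pow (by norm_num), ← pow_mul, ← ENNReal.rpow_natCast,
            ← ENNReal.rpow_natCast, ← ENNReal.rpow_mul, ← ENNReal.rpow_mul]
          push_cast
          norm_num
          congr 1
          ring
        rw [this]; ring
    _ = _ := by rw [ENNReal.tsum_mul_right, mul_assoc]

/-! ### Extrapolation to Morrey spaces -/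

lemma ae_ne_top_of_locFin {d : ℕ} {v : (Fin d → ℝ) → ℝ≥0∞} (hv : Measurable v)
    (h : ∀ c r, ∫⁻ x in closedBall c r, v x ≠ ∞) : ∀ᵐ x, v x ≠ ∞ := by
  have h1 : ∀ n : ℕ, ∀ᵐ x, x ∈ closedBall (0 : Fin d → ℝ) n → v x ≠ ∞ := fun n => by
    have := ae_lt_top hv (h 0 n)
    rw [ae_restrict_iff' measurableSet_closedBall] at this
    filter_upwards [this] with x hx hxn using (hx hxn).ne
  filter_upwards [ae_all_iff.2 h1] with x hx
  obtain ⟨n, hn⟩ := exists_nat_ge (dist x 0)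
  exact hx n (mem_closedBall.2 hn)

/-- Multiplying a Muckenhoupt weight by a function that is `A_1` relative to it. -/
lemma MuckWeight.mul {d : ℕ} {q : ℝ} {w S : (Fin d → ℝ) → ℝ≥0∞} (hw : MuckWeight q w)
    (hS : Measurable S) (hS0 : ∀ x, S x ≠ 0) {x₀ : Fin d → ℝ} (hx₀ : S x₀ ≠ ∞) {C : ℝ≥0∞}
    (hC : C ≠ ∞) (h : ∀ c r, 0 < r → ∀ x ∈ closedBall c r,
      ∫⁻ y in closedBall c r, w y * S y ≤ C * (∫⁻ y in closedBall c r, w y) * S x) :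
    MuckWeight q fun x => w x * S x := by
  have hl := hw.isLocWeight
  have hm : Measurable fun x => w x * S x := hl.measurable.mul hS
  have hfin : ∀ c r, ∫⁻ x in closedBall c r, w x * S x ≠ ∞ := by
    intro c r
    set R := max r (dist x₀ c) + 1 with hR
    have hR0 : 0 < R := by
      have : 0 ≤ max r (dist x₀ c) := le_max_of_le_right dist_nonneg
      linarith
    have h1 : ∫⁻ x in closedBall c r, w x * S x ≤ ∫⁻ x in closedBall c R, w x * S x :=
      lintegral_mono_set (closedBall_subset_closedBall (by
        have := le_max_left r (dist x₀ c); linarith))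
    refine ne_top_of_le_ne_top ?_ (h1.trans (h c R hR0 x₀ ?_))
    · exact ENNReal.mul_ne_top (ENNReal.mul_ne_top hC (hl.locFin c R)) hx₀
    · rw [mem_closedBall]
      have := le_max_right r (dist x₀ c); linarith
  have hloc : IsLocWeight fun x => w x * S x := by
    refine ⟨hm, ?_, ae_ne_top_of_locFin hm hfin, hfin⟩
    filter_upwards [hl.ne_zero] with x hx using mul_ne_zero hx (hS0 x)
  rcases hw with ⟨rfl, -, K, hK, hw⟩ | ⟨hq, -, K, hK, hw⟩
  · refine Or.inl ⟨rfl, hloc, C * K, ENNReal.mul_ne_top hC hK, fun c r hr => ?_⟩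
    filter_upwards [hw c r hr, ae_restrict_mem measurableSet_closedBall] with x hx hxB
    calc ∫⁻ y in closedBall c r, w y * S y ≤ C * (∫⁻ y in closedBall c r, w y) * S x :=
          h c r hr x hxB
      _ ≤ C * (K * volume (closedBall c r) * w x) * S x :=
          mul_le_mul_left (mul_le_mul_right hx _) _
      _ = _ := by ring
  · refine Or.inr ⟨hq, hloc, C * K, ENNReal.mul_ne_top hC hK, fun c r hr => ?_⟩
    have hq' : 0 < q - 1 := by linarith
    set e := 1 / (q - 1) with he
    have he0 : 0 < e := by positivity
    have hee : e * (q - 1) = 1 := one_div_mul_cancel hq'.ne'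
    set B := closedBall c r with hB
    set I := ∫⁻ y in B, w y with hI
    set J := ∫⁻ y in B, w y * S y with hJ
    have hpt : ∀ x ∈ B, S x ^ (-e) * J ^ e ≤ (C * I) ^ e := by
      intro x hx
      by_cases hSx : S x = ∞
      · rw [hSx, ENNReal.top_rpow_of_neg (by linarith), zero_mul]
        exact zero_le
      · calc S x ^ (-e) * J ^ e ≤ S x ^ (-e) * (C * I * S x) ^ e :=
              mul_le_mul_right (ENNReal.rpow_le_rpow (h c r hr x hx) he0.le) _
          _ = (C * I) ^ e * (S x ^ (-e) * S x ^ e) := by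
              rw [ENNReal.mul_rpow_of_nonneg _ _ he0.le]; ring
          _ = _ := by
              rw [← ENNReal.rpow_add _ _ (hS0 x) hSx, neg_add_cancel, ENNReal.rpow_zero, mul_one]
    have hJe : J ^ e ≠ ∞ := ENNReal.rpow_ne_top_of_nonneg he0.le (hfin c r)
    have hCI : (C * I) ^ e ≠ ∞ :=
      ENNReal.rpow_ne_top_of_nonneg he0.le (ENNReal.mul_ne_top hC (hl.locFin c r))
    have hdual : J ^ e * ∫⁻ y in B, (w y * S y) ^ (-e) ≤ (C * I) ^ e * ∫⁻ y in B, w y ^ (-e) := by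
      rw [← lintegral_const_mul' _ _ hJe, ← lintegral_const_mul' _ _ hCI]
      refine lintegral_mono_ae ?_
      filter_upwards [ae_restrict_mem measurableSet_closedBall, ae_restrict_of_ae hl.ne_zero]
        with x hx hwx
      rw [ENNReal.mul_rpow_of_ne_zero hwx (hS0 x)]
      calc J ^ e * (w x ^ (-e) * S x ^ (-e)) = w x ^ (-e) * (S x ^ (-e) * J ^ e) := by ring
        _ ≤ w x ^ (-e) * (C * I) ^ e := mul_le_mul_right (hpt x hx) _
        _ = _ := mul_comm _ _
    have h2 := ENNReal.rpow_le_rpow hdual hq'.le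
    rw [ENNReal.mul_rpow_of_nonneg _ _ hq'.le, ENNReal.mul_rpow_of_nonneg _ _ hq'.le,
      ← ENNReal.rpow_mul, ← ENNReal.rpow_mul, hee, ENNReal.rpow_one, ENNReal.rpow_one] at h2
    calc J * (∫⁻ y in B, (w y * S y) ^ (-e)) ^ (q - 1)
        ≤ C * I * (∫⁻ y in B, w y ^ (-e)) ^ (q - 1) := h2
      _ ≤ C * (K * volume B ^ q) := by
          rw [mul_assoc]; exact mul_le_mul_right (hw c r hr) _
      _ = _ := by ring

lemma exists_bump_ratio {d : ℕ} (hd : 0 < d) {τ ν : ℝ} (hν : 0 < ν) (hντ : ν < τ) :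
    ∃ ρ : ℝ≥0∞, ρ ≠ 0 ∧ ρ < 1 ∧ ((2 : ℝ≥0∞) ^ d)⁻¹ / ρ < 1 ∧
      ρ ^ τ * (2 : ℝ≥0∞) ^ (d * ν) < 1 := by
  have hτ : 0 < τ := hν.trans hντ
  have hd' : (0 : ℝ) < d := by exact_mod_cast hd
  have h20 : (2 : ℝ≥0∞) ≠ 0 := two_ne_zero
  have h2t : (2 : ℝ≥0∞) ≠ ∞ := ofNat_ne_top
  have h12 : (1 : ℝ≥0∞) < 2 := one_lt_two
  have hr : ν / τ < 1 := (div_lt_one hτ).2 hντ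
  have hr0 : 0 < ν / τ := by positivity
  refine ⟨2 ^ (-(d * (ν / τ + 1) / 2)), (ENNReal.rpow_pos (by simp) h2t).ne',
    ENNReal.rpow_lt_one_of_one_lt_of_neg h12 (by rw [neg_lt_zero]; positivity), ?_, ?_⟩
  · rw [ENNReal.rpow_neg, div_eq_mul_inv, inv_inv, ← ENNReal.rpow_natCast, ← ENNReal.rpow_neg,
      ← ENNReal.rpow_add _ _ h20 h2t]
    refine ENNReal.rpow_lt_one_of_one_lt_of_neg h12 ?_
    nlinarith
  · rw [← ENNReal.rpow_mul, ← ENNReal.rpow_add _ _ h20 h2t]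
    refine ENNReal.rpow_lt_one_of_one_lt_of_neg h12 ?_
    have : -(d * (ν / τ + 1) / 2) * τ + d * ν = d * (ν - τ) / 2 := by field_simp; ring
    rw [this]
    nlinarith

lemma bump_ne_zero {d : ℕ} {ρ : ℝ≥0∞} (hρ : ρ ≠ 0) (c : Fin d → ℝ) {r : ℝ} (hr : 0 < r)
    (x : Fin d → ℝ) : bump ρ c r x ≠ 0 := by
  obtain ⟨k, hk⟩ := exists_le_two_pow_mul hr (dist x c)
  exact fun h => pow_ne_zero k hρ (le_antisymm ((pow_le_bump ρ (mem_closedBall.2 hk)).trans h.le)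
    zero_le)

/-- Superposition of powers of bumps, normalised for growth of order `ν`. -/
def bumpSum {d : ℕ} (ρ : ℝ≥0∞) (τ ν : ℝ) (c : ℕ → Fin d → ℝ) (r : ℕ → ℝ) (x : Fin d → ℝ) : ℝ≥0∞ :=
  ∑' n : ℕ, 2⁻¹ ^ n * volume (closedBall (c n) (r n)) ^ (-ν) * bump ρ (c n) (r n) x ^ τ

lemma measurable_bumpSum {d : ℕ} (ρ : ℝ≥0∞) (τ ν : ℝ) (c : ℕ → Fin d → ℝ) (r : ℕ → ℝ) :
    Measurable (bumpSum ρ τ ν c r) :=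
  Measurable.tsum fun _ => ((measurable_bump _ _ _).pow_const _).const_mul _

lemma lintegral_mul_bumpSum {d : ℕ} (ρ : ℝ≥0∞) (τ ν : ℝ) (c : ℕ → Fin d → ℝ) (r : ℕ → ℝ)
    (μ : Measure (Fin d → ℝ)) {ψ : (Fin d → ℝ) → ℝ≥0∞} (hψ : Measurable ψ) :
    ∫⁻ x, ψ x * bumpSum ρ τ ν c r x ∂μ = ∑' n : ℕ,
      2⁻¹ ^ n * volume (closedBall (c n) (r n)) ^ (-ν) *
        ∫⁻ x, ψ x * bump ρ (c n) (r n) x ^ τ ∂μ := by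
  have hm : ∀ n, Measurable fun x => ψ x * bump ρ (c n) (r n) x ^ τ := fun n =>
    hψ.mul ((measurable_bump _ _ _).pow_const _)
  have h : ∀ x, ψ x * bumpSum ρ τ ν c r x = ∑' n : ℕ,
      2⁻¹ ^ n * volume (closedBall (c n) (r n)) ^ (-ν) * (ψ x * bump ρ (c n) (r n) x ^ τ) := by
    intro x
    rw [bumpSum, ← ENNReal.tsum_mul_left]
    exact tsum_congr fun n => by ring
  simp only [h]
  rw [lintegral_tsum fun n => ((hm n).const_mul _).aemeasurable]
  exact tsum_congr fun n => lintegral_const_mul _ (hm n)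

lemma lintegral_mul_bumpSum_le {d : ℕ} {τ ν : ℝ} (hτ0 : 0 < τ) (hτ1 : τ ≤ 1) (hν : 0 ≤ ν)
    (ρ : ℝ≥0∞) {ψ : (Fin d → ℝ) → ℝ≥0∞} (hψ : Measurable ψ) {N : ℝ≥0∞}
    (hN : ∀ c r, 0 < r → ∫⁻ x in closedBall c r, ψ x ≤ N * volume (closedBall c r) ^ ν)
    (c : ℕ → Fin d → ℝ) {r : ℕ → ℝ} (hr : ∀ n, 0 < r n) :
    ∫⁻ x, ψ x * bumpSum ρ τ ν c r x ≤
      2 * (∑' k : ℕ, (ρ ^ τ * (2 : ℝ≥0∞) ^ (d * ν)) ^ k) * N := by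
  rw [lintegral_mul_bumpSum ρ τ ν c r volume hψ]
  set A := ∑' k : ℕ, (ρ ^ τ * (2 : ℝ≥0∞) ^ (d * ν)) ^ k
  have h2 : ∑' n : ℕ, (2⁻¹ : ℝ≥0∞) ^ n = 2 := by
    rw [ENNReal.tsum_geometric, ENNReal.one_sub_inv_two, inv_inv]
  calc _ ≤ ∑' n : ℕ, (2⁻¹ : ℝ≥0∞) ^ n * (A * N) := by
        refine ENNReal.tsum_le_tsum fun n => ?_
        refine (mul_le_mul_right
          (lintegral_mul_bump_rpow_le hτ0 hτ1 hν ρ hψ hN (c n) (hr n)) _).trans (le_of_eq ?_)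
        calc _ = 2⁻¹ ^ n * (A * N) * (volume (closedBall (c n) (r n)) ^ (-ν) *
              volume (closedBall (c n) (r n)) ^ ν) := by ring
          _ = _ := by
            rw [← ENNReal.rpow_add _ _ (volume_closedBall_ne_zero _ (hr n))
              (volume_closedBall_ne_top _ _), neg_add_cancel, ENNReal.rpow_zero, mul_one]
    _ = _ := by rw [ENNReal.tsum_mul_right, h2, mul_assoc]

lemma bumpSum_ne_zero {d : ℕ} {ρ : ℝ≥0∞} (hρ : ρ ≠ 0) {τ ν : ℝ} (hτ : 0 < τ)
    (c : ℕ → Fin d → ℝ) {r : ℕ → ℝ} (hr : ∀ n, 0 < r n) (x : Fin d → ℝ) :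
    bumpSum ρ τ ν c r x ≠ 0 := by
  intro h
  rw [bumpSum, ENNReal.tsum_eq_zero] at h
  have h0 := h 0
  rw [pow_zero, one_mul, mul_eq_zero, ENNReal.rpow_eq_zero_iff_of_pos hτ] at h0
  rcases h0 with h0 | h0
  · exact (ENNReal.rpow_pos (pos_iff_ne_zero.2 (volume_closedBall_ne_zero _ (hr 0)))
      (volume_closedBall_ne_top _ _)).ne' h0
  · exact bump_ne_zero hρ _ (hr 0) x h0

lemma exists_bumpSum_ne_top {d : ℕ} {ρ : ℝ≥0∞} {τ ν : ℝ} (hτ0 : 0 < τ) (hτ1 : τ ≤ 1)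
    (hν0 : 0 < ν) (hν1 : ν ≤ 1) (hρ : ρ ^ τ * (2 : ℝ≥0∞) ^ (d * ν) < 1)
    (c : ℕ → Fin d → ℝ) {r : ℕ → ℝ} (hr : ∀ n, 0 < r n) : ∃ x, bumpSum ρ τ ν c r x ≠ ∞ := by
  by_contra! hcon
  set B := closedBall (0 : Fin d → ℝ) (1 / 2) with hB
  have hvB : volume B = 1 := by
    rw [hB, Real.volume_pi_closedBall _ (by norm_num)]; norm_num
  set ψ : (Fin d → ℝ) → ℝ≥0∞ := B.indicator fun _ => 1 with hψ
  have hψm : Measurable ψ := measurable_const.indicator measurableSet_closedBall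
  have h := lintegral_mul_bumpSum_le hτ0 hτ1 hν0.le ρ hψm (N := 1) (fun b s hs => by
    rw [hψ, lintegral_indicator measurableSet_closedBall, setLIntegral_const, one_mul, one_mul,
      Measure.restrict_apply measurableSet_closedBall]
    rcases le_total (volume (closedBall b s)) 1 with h1 | h1
    · refine (measure_mono Set.inter_subset_right).trans ?_
      calc volume (closedBall b s) = volume (closedBall b s) ^ (1 : ℝ) := (ENNReal.rpow_one _).symm
        _ ≤ _ := ENNReal.rpow_le_rpow_of_exponent_ge h1 hν1
    · refine (measure_mono Set.inter_subset_left).trans (hvB.le.trans ?_)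
      exact ENNReal.one_le_rpow h1 hν0) c hr
  simp only [hcon] at h
  rw [lintegral_mul_const _ hψm, hψ, lintegral_indicator measurableSet_closedBall,
    setLIntegral_const, hvB, one_mul, one_mul, mul_one, top_le_iff] at h
  refine ENNReal.mul_ne_top ofNat_ne_top ?_ h
  rw [ENNReal.tsum_geometric]
  exact ENNReal.inv_ne_top.2 (tsub_pos_of_lt hρ).ne'

/-- Extrapolation from weighted Lebesgue bounds to weighted Morrey bounds, for families of pairs. -/
lemma morrey_extrapolation {d : ℕ} (hd : 0 < d) {q q₁ σ ν : ℝ} (hq₁ : 1 ≤ q₁) (hσ : 1 < σ)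
    (hν0 : 0 < ν) (hν : ν < 1 - 1 / σ) {ι : Type*} {F G : ι → (Fin d → ℝ) → ℝ≥0∞}
    (hF : ∀ i, Measurable (F i)) (hG : ∀ i, Measurable (G i))
    (h : ∀ W, MuckWeight q₁ W → ∃ C, C ≠ ∞ ∧ ∀ i,
      ∫⁻ x, G i x ^ q₁ * W x ≤ C * ∫⁻ x, F i x ^ q₁ * W x)
    (hq : 1 < q ∨ q = q₁) {w : (Fin d → ℝ) → ℝ≥0∞} (hw : MuckWeight q w) {K : ℝ≥0∞} (hK : K ≠ ∞)
    (hRH : ∀ c r, 0 < r → (∫⁻ x in closedBall c r, w x ^ σ) ^ (1 / σ) ≤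
      K * volume (closedBall c r) ^ (1 / σ - 1) * ∫⁻ x in closedBall c r, w x) :
    ∃ C, C ≠ ∞ ∧ ∀ i N,
      (∀ c r, 0 < r → ∫⁻ x in closedBall c r, F i x ^ q * w x ≤ N * volume (closedBall c r) ^ ν) →
      ∀ c r, 0 < r →
        ∫⁻ x in closedBall c r, G i x ^ q * w x ≤ C * N * volume (closedBall c r) ^ ν := by
  by_contra! hcon
  choose i N hN c r hr hlt using fun n : ℕ => hcon (4 ^ n) (by simp)
  have hτ0 : 0 < 1 - 1 / σ := hν0.trans hν
  have hτ1 : 1 - 1 / σ ≤ 1 := by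
    have : 0 < 1 / σ := by positivity
    linarith
  obtain ⟨ρ, hρ0, hρ1, hρd, hρτ⟩ := exists_bump_ratio hd hν0 hν
  obtain ⟨C₁, hC₁, hU⟩ := setLIntegral_bump_le d hρ0 hρ1 hρd
  set τ := 1 - 1 / σ with hτ
  set S := bumpSum ρ τ ν c r with hS
  have hl := hw.isLocWeight
  obtain ⟨x₀, hx₀⟩ := exists_bumpSum_ne_top hτ0 hτ1 hν0 (hν.le.trans hτ1) hρτ c hr
  have hV : MuckWeight q fun x => w x * S x := by
    refine hw.mul (measurable_bumpSum ..) (bumpSum_ne_zero hρ0 hτ0 c hr) hx₀ (C := K * C₁ ^ τ)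
      (ENNReal.mul_ne_top hK (ENNReal.rpow_ne_top_of_nonneg hτ0.le hC₁)) fun b s hs x hx => ?_
    rw [hS, lintegral_mul_bumpSum ρ τ ν c r _ hl.measurable, bumpSum, ← ENNReal.tsum_mul_left]
    refine ENNReal.tsum_le_tsum fun n => ?_
    refine (mul_le_mul_right (setLIntegral_mul_bump_rpow_le hσ hl.measurable hRH
      (hU (c n) (r n) (hr n)) b hs hx) _).trans (le_of_eq ?_)
    ring
  obtain ⟨C₂, hC₂, hE⟩ := extrapolation hq₁ hF hG h hq hV
  set A := ∑' k : ℕ, (ρ ^ τ * (2 : ℝ≥0∞) ^ (d * ν)) ^ k with hA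
  have hAt : A ≠ ∞ := by
    rw [hA, ENNReal.tsum_geometric]
    exact ENNReal.inv_ne_top.2 (tsub_pos_of_lt hρτ).ne'
  obtain ⟨n, hn⟩ := exists_lt_two_pow
    (ENNReal.mul_ne_top hC₂ (ENNReal.mul_ne_top (ofNat_ne_top (n := 2)) hAt))
  set B := closedBall (c n) (r n) with hB
  have hB0 : volume B ≠ 0 := volume_closedBall_ne_zero _ (hr n)
  have hBt : volume B ≠ ∞ := volume_closedBall_ne_top _ _
  have hSB : ∀ x ∈ B, 1 ≤ 2 ^ n * volume B ^ ν * S x := by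
    intro x hx
    have h1 : (1 : ℝ≥0∞) ≤ bump ρ (c n) (r n) x ^ τ := by
      refine ENNReal.one_le_rpow ?_ hτ0
      rw [← pow_zero ρ]
      exact pow_le_bump ρ (by rwa [pow_zero, one_mul])
    have h2 : 2⁻¹ ^ n * volume B ^ (-ν) * bump ρ (c n) (r n) x ^ τ ≤ S x :=
      ENNReal.le_tsum (f := fun n =>
        2⁻¹ ^ n * volume (closedBall (c n) (r n)) ^ (-ν) * bump ρ (c n) (r n) x ^ τ) n
    calc (1 : ℝ≥0∞) = (2 * 2⁻¹) ^ n * (volume B ^ ν * volume B ^ (-ν)) * 1 := by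
          rw [ENNReal.mul_inv_cancel two_ne_zero ofNat_ne_top, ← ENNReal.rpow_add _ _ hB0 hBt,
            add_neg_cancel, ENNReal.rpow_zero]
          simp
      _ ≤ (2 * 2⁻¹) ^ n * (volume B ^ ν * volume B ^ (-ν)) * bump ρ (c n) (r n) x ^ τ :=
          mul_le_mul_right h1 _
      _ = 2 ^ n * volume B ^ ν * (2⁻¹ ^ n * volume B ^ (-ν) * bump ρ (c n) (r n) x ^ τ) := by
          rw [mul_pow]; ring
      _ ≤ _ := mul_le_mul_right h2 _
  have hc : 2 ^ n * volume B ^ ν ≠ ∞ :=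
    ENNReal.mul_ne_top (by simp) (ENNReal.rpow_ne_top_of_nonneg hν0.le hBt)
  have hψ : Measurable fun x => F (i n) x ^ q * w x := ((hF _).pow_const _).mul hl.measurable
  refine (hlt n).not_ge ?_
  calc ∫⁻ x in B, G (i n) x ^ q * w x
      ≤ ∫⁻ x in B, 2 ^ n * volume B ^ ν * (G (i n) x ^ q * (w x * S x)) := by
        refine setLIntegral_mono' measurableSet_closedBall fun x hx => ?_
        calc G (i n) x ^ q * w x = G (i n) x ^ q * w x * 1 := (mul_one _).symm
          _ ≤ G (i n) x ^ q * w x * (2 ^ n * volume B ^ ν * S x) := mul_le_mul_right (hSB x hx) _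
          _ = _ := by ring
    _ = 2 ^ n * volume B ^ ν * ∫⁻ x in B, G (i n) x ^ q * (w x * S x) :=
        lintegral_const_mul' _ _ hc
    _ ≤ 2 ^ n * volume B ^ ν * ∫⁻ x, G (i n) x ^ q * (w x * S x) :=
        mul_le_mul_right (setLIntegral_le_lintegral _ _) _
    _ ≤ 2 ^ n * volume B ^ ν * (C₂ * ∫⁻ x, F (i n) x ^ q * (w x * S x)) :=
        mul_le_mul_right (hE (i n)) _
    _ = 2 ^ n * volume B ^ ν * (C₂ * ∫⁻ x, F (i n) x ^ q * w x * S x) := by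
        simp only [mul_assoc]
    _ ≤ 2 ^ n * volume B ^ ν * (C₂ * (2 * A * N n)) :=
        mul_le_mul_right (mul_le_mul_right
          (lintegral_mul_bumpSum_le hτ0 hτ1 hν0.le ρ hψ (hN n) c hr) _) _
    _ = 2 ^ n * (C₂ * (2 * A)) * (N n * volume B ^ ν) := by ring
    _ ≤ 2 ^ n * 2 ^ n * (N n * volume B ^ ν) := mul_le_mul_left (mul_le_mul_right hn.le _) _
    _ = 4 ^ n * N n * volume B ^ ν := by
        rw [← mul_pow]; norm_num; ring

/-! ### Measurable minorants -/

/-- Every function has an a.e. largest measurable minorant. -/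
lemma exists_maximal_measurable_minorant {α : Type*} [MeasurableSpace α] (μ : Measure α) [SFinite μ]
    (F : α → ℝ≥0∞) : ∃ m : α → ℝ≥0∞, Measurable m ∧ m ≤ F ∧
      ∀ g, Measurable g → g ≤ F → ∀ᵐ x ∂μ, g x ≤ m x := by
  obtain ⟨ν, hν, hμν, -⟩ := exists_isFiniteMeasure_absolutelyContinuous μ
  choose m hm hmle hmint using fun k : ℕ =>
    exists_measurable_le_lintegral_eq ν (fun x => min (F x) (k : ℝ≥0∞))
  refine ⟨fun x => ⨆ k, m k x, Measurable.iSup hm,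
    fun x => iSup_le fun k => (hmle k x).trans (min_le_left _ _), fun g hg hgF => hμν.ae_le ?_⟩
  have hk : ∀ k : ℕ, ∀ᵐ x ∂ν, min (g x) (k : ℝ≥0∞) ≤ m k x := by
    intro k
    have hmax : Measurable fun x => max (m k x) (min (g x) (k : ℝ≥0∞)) :=
      (hm k).max (hg.min measurable_const)
    have hfin : ∫⁻ x, m k x ∂ν ≠ ∞ := by
      refine ne_top_of_le_ne_top (b := ∫⁻ _, (k : ℝ≥0∞) ∂ν) ?_
        (lintegral_mono fun x => (hmle k x).trans (min_le_right _ _))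
      rw [lintegral_const]
      exact ENNReal.mul_ne_top (natCast_ne_top k) (measure_ne_top ν _)
    have := ae_eq_of_ae_le_of_lintegral_le (f := m k)
      (g := fun x => max (m k x) (min (g x) (k : ℝ≥0∞)))
      (Eventually.of_forall fun x => le_max_left _ _) hfin hmax.aemeasurable
      ((lintegral_mono fun x => max_le (hmle k x) (min_le_min_right _ (hgF x))).trans
        (hmint k).le)
    filter_upwards [this] with x hx
    rw [hx]
    exact le_max_right _ _
  filter_upwards [ae_all_iff.2 hk] with x hx
  calc g x = min (g x) (⨆ k : ℕ, (k : ℝ≥0∞)) := by rw [ENNReal.iSup_natCast, min_top_right]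
    _ = ⨆ k : ℕ, min (g x) (k : ℝ≥0∞) := inf_iSup_eq _ _
    _ ≤ _ := iSup_mono hx

lemma setLIntegral_eq_of_minorant {α : Type*} [MeasurableSpace α] {μ : Measure α}
    {F m w : α → ℝ≥0∞} (hmF : m ≤ F)
    (h : ∀ g, Measurable g → g ≤ F → ∀ᵐ x ∂μ, g x ≤ m x) (hw : Measurable w)
    (hwt : ∀ᵐ x ∂μ, w x ≠ ∞) {p : ℝ} (hp : 0 < p) (A : Set α) :
    ∫⁻ x in A, F x ^ p * w x ∂μ = ∫⁻ x in A, m x ^ p * w x ∂μ := by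
  refine le_antisymm ?_ (lintegral_mono fun x =>
    mul_le_mul_left (ENNReal.rpow_le_rpow (hmF x) hp.le) _)
  obtain ⟨g, hg, hgle, hgint⟩ :=
    exists_measurable_le_lintegral_eq (μ.restrict A) (fun x => F x ^ p * w x)
  rw [hgint]
  refine lintegral_mono_ae (ae_restrict_of_ae ?_)
  filter_upwards [hwt, h (fun x => (g x / w x) ^ p⁻¹) ((hg.div hw).pow_const _) fun x =>
    (ENNReal.rpow_inv_le_iff hp).2 (ENNReal.div_le_of_le_mul (hgle x))] with x hx hgx
  rw [ENNReal.rpow_inv_le_iff hp] at hgx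
  by_cases hw0 : w x = 0
  · have := hgle x
    simp only [hw0, mul_zero] at this ⊢
    exact this
  · exact (ENNReal.div_le_iff hw0 hx).1 hgx

/-! ### Cubes and closed balls -/

lemma cube_eq_closedBall {d : ℕ} (a : Fin d → ℝ) {r : ℝ} (hr : 0 ≤ r) :
    cube a r = closedBall (fun i => a i + r / 2) (r / 2) := by
  rw [closedBall_pi _ (by positivity), cube]
  congr 1
  funext i
  rw [Real.closedBall_eq_Icc]
  congr 1 <;> ring

lemma closedBall_eq_cube {d : ℕ} (c : Fin d → ℝ) {r : ℝ} (hr : 0 ≤ r) :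
    closedBall c r = cube (fun i => c i - r) (2 * r) := by
  rw [cube_eq_closedBall _ (by positivity)]
  congr 1
  · funext i; ring
  · ring

lemma avg_mul_avg_rpow_le_iff {I J V K : ℝ≥0∞} (h0 : V ≠ 0) (ht : V ≠ ∞) {s : ℝ} (hs : 1 < s) :
    I / V * (J / V) ^ (s - 1) ≤ K ↔ I * J ^ (s - 1) ≤ K * V ^ s := by
  have hs' : 0 ≤ s - 1 := by linarith
  have e : V ^ s = V * V ^ (s - 1) := by
    nth_rw 2 [← ENNReal.rpow_one V]
    rw [← ENNReal.rpow_add _ _ h0 ht]; congr 1; ring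
  have hs0 : V ^ s ≠ 0 := (ENNReal.rpow_pos (pos_iff_ne_zero.2 h0) ht).ne'
  have hst : V ^ s ≠ ∞ := ENNReal.rpow_ne_top_of_nonneg (by linarith) ht
  rw [← ENNReal.div_le_iff hs0 hst, ENNReal.div_rpow_of_nonneg _ _ hs']
  have : I / V * (J ^ (s - 1) / V ^ (s - 1)) = I * J ^ (s - 1) / V ^ s := by
    rw [e]
    simp only [div_eq_mul_inv]
    rw [ENNReal.mul_inv (Or.inl h0) (Or.inl ht)]; ring
  rw [this]

lemma isLocWeight_of_isWeight {d : ℕ} {w : (Fin d → ℝ) → ℝ} (hw : IsWeight d w)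
    {v : (Fin d → ℝ) → ℝ≥0∞} (hv : Measurable v) (hvw : ofW w =ᵐ[volume] v) : IsLocWeight v := by
  refine ⟨hv, ?_, ?_, fun c r => ?_⟩
  · filter_upwards [hvw, hw.2] with x hx h0
    rw [← hx, ofW]
    exact (ENNReal.ofReal_pos.2 h0).ne'
  · filter_upwards [hvw] with x hx
    rw [← hx, ofW]
    exact ofReal_ne_top
  · rw [← lintegral_congr_ae (ae_restrict_of_ae hvw)]
    exact (hw.1.integrableOn_isCompact (isCompact_closedBall c r)).lintegral_lt_top.ne

lemma muckWeight_of_memAp {d : ℕ} {s : ℝ} (hs : 1 ≤ s) {w : (Fin d → ℝ) → ℝ} (hw : MemAp d s w)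
    {v : (Fin d → ℝ) → ℝ≥0∞} (hv : Measurable v) (hvw : ofW w =ᵐ[volume] v) : MuckWeight s v := by
  obtain ⟨hw, hK⟩ := hw
  have hl := isLocWeight_of_isWeight hw hv hvw
  have hcongr : ∀ c r, ∫⁻ y in closedBall c r, ofW w y = ∫⁻ y in closedBall c r, v y :=
    fun c r => lintegral_congr_ae (ae_restrict_of_ae hvw)
  rcases hs.eq_or_lt with rfl | hs
  · refine Or.inl ⟨rfl, hl, apConst d 1 w, hK, fun c r hr => ?_⟩
    have h1 : avg (ofW w) (fun i => c i - r) (2 * r) *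
        essSup (fun x => (ofW w x)⁻¹) (volume.restrict (cube (fun i => c i - r) (2 * r))) ≤
        apConst d 1 w := by
      rw [apConst, if_pos rfl]
      exact le_iSup₂_of_le (fun i => c i - r) (2 * r) (le_iSup_of_le (by positivity) le_rfl)
    rw [avg, ← closedBall_eq_cube c hr.le, hcongr] at h1
    have h2 := ENNReal.ae_le_essSup (μ := volume.restrict (closedBall c r))
      (fun x => (ofW w x)⁻¹)
    filter_upwards [h2, ae_restrict_of_ae hvw, ae_restrict_of_ae hl.ne_zero,
      ae_restrict_of_ae hl.ne_top] with x hx hxv h0 ht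
    rw [hxv] at hx
    have h3 := (mul_le_mul_right hx _).trans h1
    rw [← div_eq_mul_inv, ENNReal.div_le_iff h0 ht,
      ENNReal.div_le_iff (volume_closedBall_ne_zero c hr) (volume_closedBall_ne_top c r)] at h3
    calc _ ≤ _ := h3
      _ = _ := by ring
  · refine Or.inr ⟨hs, hl, apConst d s w, hK, fun c r hr => ?_⟩
    have h1 : avg (ofW w) (fun i => c i - r) (2 * r) *
        (avg (fun x => ofW w x ^ (-(1 / (s - 1)))) (fun i => c i - r) (2 * r)) ^ (s - 1) ≤
        apConst d s w := by
      rw [apConst, if_neg hs.ne']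
      exact le_iSup₂_of_le (fun i => c i - r) (2 * r) (le_iSup_of_le (by positivity) le_rfl)
    rw [avg, avg, ← closedBall_eq_cube c hr.le, hcongr, avg_mul_avg_rpow_le_iff
      (volume_closedBall_ne_zero c hr) (volume_closedBall_ne_top c r) hs] at h1
    refine le_trans (le_of_eq ?_) h1
    congr 2
    refine lintegral_congr_ae (ae_restrict_of_ae ?_)
    filter_upwards [hvw] with x hx
    rw [hx]

lemma ofW_toReal {d : ℕ} {W : (Fin d → ℝ) → ℝ≥0∞} (hW : IsLocWeight W) :
    ofW (fun x => (W x).toReal) =ᵐ[volume] W := by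
  filter_upwards [hW.ne_top] with x hx
  rw [ofW, ENNReal.ofReal_toReal hx]

lemma memAp_toReal {d : ℕ} {s : ℝ} {W : (Fin d → ℝ) → ℝ≥0∞} (hW : MuckWeight s W) :
    MemAp d s fun x => (W x).toReal := by
  have hl := hW.isLocWeight
  have he := ofW_toReal hl
  refine ⟨⟨?_, ?_⟩, ?_⟩
  · intro x
    refine ⟨closedBall x 1, closedBall_mem_nhds x one_pos, ?_⟩
    exact integrable_toReal_of_lintegral_ne_top hl.measurable.aemeasurable (hl.locFin x 1)
  · filter_upwards [hl.ne_zero, hl.ne_top] with x h0 ht using ENNReal.toReal_pos h0 ht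
  · have hcongr : ∀ c r, ∫⁻ y in closedBall c r, ofW (fun x => (W x).toReal) y =
        ∫⁻ y in closedBall c r, W y := fun c r => lintegral_congr_ae (ae_restrict_of_ae he)
    rcases hW with ⟨rfl, -, K, hK, h⟩ | ⟨hs, -, K, hK, h⟩
    · rw [apConst, if_pos rfl]
      refine ne_top_of_le_ne_top hK (iSup_le fun a => iSup_le fun r => iSup_le fun hr => ?_)
      have hr2 : 0 < r / 2 := by positivity
      rw [avg, cube_eq_closedBall a hr.le, hcongr]
      set c : Fin d → ℝ := fun i => a i + r / 2
      set I := ∫⁻ y in closedBall c (r / 2), W y with hI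
      have hV0 := volume_closedBall_ne_zero c hr2
      have hVt := volume_closedBall_ne_top c (r / 2)
      have hI0 : I ≠ 0 := setLIntegral_ne_zero hl.measurable hl.ne_zero c hr2
      have hIt : I ≠ ∞ := hl.locFin c _
      have : essSup (fun x => (ofW (fun x => (W x).toReal) x)⁻¹)
          (volume.restrict (closedBall c (r / 2))) ≤ K * volume (closedBall c (r / 2)) / I := by
        refine essSup_le_of_ae_le _ ?_
        filter_upwards [h c _ hr2, ae_restrict_of_ae he, ae_restrict_of_ae hl.ne_zero,
          ae_restrict_of_ae hl.ne_top] with x hx hxW h0 ht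
        rw [hxW, ENNReal.le_div_iff_mul_le (Or.inl hI0) (Or.inl hIt), mul_comm, ← div_eq_mul_inv,
          ENNReal.div_le_iff h0 ht]
        exact hx
      refine (mul_le_mul_right this _).trans (le_of_eq ?_)
      calc I / volume (closedBall c (r / 2)) * (K * volume (closedBall c (r / 2)) / I)
          = K * (I * I⁻¹) * (volume (closedBall c (r / 2)) * (volume (closedBall c (r / 2)))⁻¹) := by
            simp only [div_eq_mul_inv]; ring
        _ = K := by
            rw [ENNReal.mul_inv_cancel hI0 hIt, ENNReal.mul_inv_cancel hV0 hVt, mul_one, mul_one]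
    · rw [apConst, if_neg hs.ne']
      refine ne_top_of_le_ne_top hK (iSup_le fun a => iSup_le fun r => iSup_le fun hr => ?_)
      have hr2 : 0 < r / 2 := by positivity
      rw [avg, avg, cube_eq_closedBall a hr.le, hcongr, avg_mul_avg_rpow_le_iff
        (volume_closedBall_ne_zero _ hr2) (volume_closedBall_ne_top _ _) hs]
      refine le_trans (le_of_eq ?_) (h _ _ hr2)
      congr 2
      refine lintegral_congr_ae (ae_restrict_of_ae ?_)
      filter_upwards [he] with x hx
      rw [hx]

lemma exists_reverse_holder {d : ℕ} {σ : ℝ} (hσ : 1 < σ) {w : (Fin d → ℝ) → ℝ}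
    (hw : MemRH d (ENNReal.ofReal σ) w) {v : (Fin d → ℝ) → ℝ≥0∞} (hv : Measurable v)
    (hvw : ofW w =ᵐ[volume] v) : ∃ K : ℝ≥0∞, K ≠ ∞ ∧ ∀ c r, 0 < r →
      (∫⁻ x in closedBall c r, v x ^ σ) ^ (1 / σ) ≤
      K * volume (closedBall c r) ^ (1 / σ - 1) * ∫⁻ x in closedBall c r, v x := by
  obtain ⟨hw, hK⟩ := hw
  have hl := isLocWeight_of_isWeight hw hv hvw
  have hσ0 : 0 < σ := by linarith
  refine ⟨_, hK, fun c r hr => ?_⟩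
  have h1 : (avg (fun x => ofW w x ^ σ) (fun i => c i - r) (2 * r)) ^ (1 / σ) /
      avg (ofW w) (fun i => c i - r) (2 * r) ≤ rhConst d (ENNReal.ofReal σ) w := by
    rw [rhConst, if_neg (by rw [ENNReal.ofReal_eq_one]; exact hσ.ne'), if_neg ofReal_ne_top,
      ENNReal.toReal_ofReal hσ0.le]
    exact le_iSup₂_of_le (fun i => c i - r) (2 * r) (le_iSup_of_le (by positivity) le_rfl)
  have e1 : ∫⁻ y in closedBall c r, ofW w y = ∫⁻ y in closedBall c r, v y :=
    lintegral_congr_ae (ae_restrict_of_ae hvw)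
  have e2 : ∫⁻ y in closedBall c r, ofW w y ^ σ = ∫⁻ y in closedBall c r, v y ^ σ := by
    refine lintegral_congr_ae (ae_restrict_of_ae ?_)
    filter_upwards [hvw] with x hx
    rw [hx]
  rw [avg, avg, ← closedBall_eq_cube c hr.le, e1, e2] at h1
  have hV0 := volume_closedBall_ne_zero c hr
  have hVt := volume_closedBall_ne_top c r
  set V := volume (closedBall c r)
  set I := ∫⁻ y in closedBall c r, v y
  have hI0 : I ≠ 0 := setLIntegral_ne_zero hl.measurable hl.ne_zero c hr
  have hIt : I ≠ ∞ := hl.locFin c _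
  rw [ENNReal.div_le_iff (ENNReal.div_ne_zero.2 ⟨hI0, hVt⟩) (ENNReal.div_ne_top hIt hV0)] at h1
  rw [← div_rpow_mul_rpow hV0 hVt (by positivity : (0 : ℝ) ≤ 1 / σ)]
  refine (mul_le_mul_left h1 _).trans (le_of_eq ?_)
  rw [ENNReal.rpow_sub _ _ hV0 hVt, ENNReal.rpow_one]
  simp only [div_eq_mul_inv]
  ring

lemma morrey_term_le_iff {V X M : ℝ≥0∞} (h0 : V ≠ 0) (ht : V ≠ ∞) {p lam δ : ℝ} (hp : 0 < p) :
    V ^ (-(lam / (δ * p))) * X ^ (1 / p) ≤ M ↔ X ≤ M ^ p * V ^ (lam / δ) := by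
  have e : V ^ (-(lam / (δ * p))) * X ^ (1 / p) = (X / V ^ (lam / δ)) ^ p⁻¹ := by
    have e : lam / (δ * p) = lam / δ * p⁻¹ := by rw [← div_eq_mul_inv, div_div]
    rw [ENNReal.div_rpow_of_nonneg _ _ (by positivity), ← ENNReal.rpow_mul, one_div, ENNReal.rpow_neg,
      e, mul_comm, ← div_eq_mul_inv]
  rw [e, ENNReal.rpow_inv_le_iff hp, ENNReal.div_le_iff
    (ENNReal.rpow_pos (pos_iff_ne_zero.2 h0) ht).ne' (ENNReal.rpow_ne_top_of_ne_zero h0 ht)]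

end WeightedMorrey

open WeightedMorrey

/-- **Duoandikoetxea–Rosenthal extrapolation to weighted Morrey spaces.**
Let `1 ≤ κ ≤ p₁ < ∞` and let `T` be defined and bounded on `L^{p₁}(w)` for all
`w ∈ A_{p₁/κ}`. Then for every `σ ∈ (1,∞)`, `T` is bounded on `𝓛^{p,λ}(w)` for all
`p ∈ (κ,∞)` (also `p = κ` if `p₁ = κ`), all `0 < λ < d - d/σ`, and all
`w ∈ A_{p/κ} ∩ RH_σ`. -/
theorem duoandikoetxea_rosenthal_extrapolation
    (d : ℕ) (κ p1 : ℝ) (hκ : 1 ≤ κ) (hκp1 : κ ≤ p1)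
    (T : ((Fin d → ℝ) → ℂ) → ((Fin d → ℝ) → ℂ))
    (hbdd : ∀ w : (Fin d → ℝ) → ℝ, MemAp d (p1 / κ) w →
      OpBounded (wLpNorm d p1 w) (wLpNorm d p1 w) T) :
    ∀ (σ p lam : ℝ) (w : (Fin d → ℝ) → ℝ),
      1 < σ → (κ < p ∨ (p = κ ∧ p1 = κ)) →
      0 < lam → lam < d - d / σ →
      MemAp d (p / κ) w → MemRH d (ENNReal.ofReal σ) w →
      OpBounded (morreyNorm d p lam w) (morreyNorm d p lam w) T := by
  intro σ p lam w hσ hp hlam0 hlam hwA hwR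
  have hσ0 : 0 < σ := by linarith
  have hκ0 : 0 < κ := by linarith
  have hp10 : 0 < p1 := by linarith
  have hκp : κ ≤ p := hp.elim le_of_lt fun h => h.1.ge
  have hp0 : 0 < p := by linarith
  have hd : 0 < d := by
    rcases Nat.eq_zero_or_pos d with rfl | hd
    · norm_num at hlam; linarith
    · exact hd
  have hd' : (0 : ℝ) < d := by exact_mod_cast hd
  have hν : lam / d < 1 - 1 / σ := by
    rw [div_lt_iff₀ hd']
    calc lam < d - d / σ := hlam
      _ = _ := by ring
  have hq : 1 < p / κ ∨ p / κ = p1 / κ := by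
    rcases hp with h | ⟨h1, h2⟩
    · exact Or.inl ((one_lt_div hκ0).2 h)
    · exact Or.inr (by rw [h1, h2])
  have hwm : AEMeasurable (ofW w) volume :=
    hwA.1.1.aestronglyMeasurable.aemeasurable.ennreal_ofReal
  have hvm := hwm.measurable_mk
  have hvw : ofW w =ᵐ[volume] hwm.mk (ofW w) := hwm.ae_eq_mk
  set v := hwm.mk (ofW w)
  have hvA : MuckWeight (p / κ) v := muckWeight_of_memAp ((one_le_div hκ0).2 hκp) hwA hvm hvw
  have hvl := hvA.isLocWeight
  obtain ⟨K, hK, hRH⟩ := exists_reverse_holder hσ hwR hvm hvw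
  choose E hEm hEle hEmax using fun f : (Fin d → ℝ) → ℂ =>
    exists_maximal_measurable_minorant volume fun x => (‖f x‖₊ : ℝ≥0∞)
  have hpow : ∀ s a, (a ^ κ : ℝ≥0∞) ^ (s / κ) = a ^ s := fun s a => by
    rw [← ENNReal.rpow_mul, mul_div_cancel₀ _ hκ0.ne']
  have hset : ∀ {W : (Fin d → ℝ) → ℝ≥0∞} {u : (Fin d → ℝ) → ℝ}, IsLocWeight W →
      ofW u =ᵐ[volume] W → ∀ {s : ℝ}, 0 < s → ∀ (A : Set (Fin d → ℝ)) f,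
      ∫⁻ x in A, (‖f x‖₊ : ℝ≥0∞) ^ s * ofW u x = ∫⁻ x in A, (E f x ^ κ) ^ (s / κ) * W x := by
    intro W u hW hu s hs A f
    simp only [hpow]
    rw [← setLIntegral_eq_of_minorant (hEle f) (hEmax f) hW.measurable hW.ne_top hs A]
    refine lintegral_congr_ae (ae_restrict_of_ae ?_)
    filter_upwards [hu] with x hx
    rw [hx]
  obtain ⟨C, hC, h⟩ := morrey_extrapolation hd (q := p / κ) (q₁ := p1 / κ) (ν := lam / d)
    ((one_le_div hκ0).2 hκp1) hσ (by positivity) hν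
    (F := fun f x => E f x ^ κ) (G := fun f x => E (T f) x ^ κ)
    (fun f => (hEm f).pow_const _) (fun f => (hEm (T f)).pow_const _)
    (fun W hW => by
      obtain ⟨C, hC, hb⟩ := hbdd _ (memAp_toReal hW)
      refine ⟨C ^ p1, ENNReal.rpow_ne_top_of_nonneg hp10.le hC, fun f => ?_⟩
      have he := ofW_toReal hW.isLocWeight
      have h1 := fun f => hset hW.isLocWeight he hp10 Set.univ f
      simp only [Measure.restrict_univ] at h1
      have h2 := hb f
      rw [wLpNorm, wLpNorm, h1, h1, one_div, ENNReal.rpow_inv_le_iff hp10,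
        ENNReal.mul_rpow_of_nonneg _ _ hp10.le, ← ENNReal.rpow_mul, inv_mul_cancel₀ hp10.ne',
        ENNReal.rpow_one] at h2
      exact h2) hq hvA hK hRH
  refine ⟨C ^ p⁻¹, ENNReal.rpow_ne_top_of_nonneg (by positivity) hC, fun f => ?_⟩
  refine iSup_le fun a => iSup_le fun r => iSup_le fun hr => ?_
  have hr2 : 0 < r / 2 := by positivity
  rw [cube_eq_closedBall a hr.le, morrey_term_le_iff (volume_closedBall_ne_zero _ hr2)
    (volume_closedBall_ne_top _ _) hp0, hset hvl hvw hp0, ENNReal.mul_rpow_of_nonneg _ _ hp0.le,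
    ← ENNReal.rpow_mul, inv_mul_cancel₀ hp0.ne', ENNReal.rpow_one]
  refine h f _ (fun c s hs => ?_) _ _ hr2
  rw [← hset hvl hvw hp0, ← morrey_term_le_iff (volume_closedBall_ne_zero _ hs)
    (volume_closedBall_ne_top _ _) hp0, closedBall_eq_cube c hs.le]
  exact le_iSup₂_of_le (fun i => c i - s) (2 * s) (le_iSup_of_le (by positivity) le_rfl)
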